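/- arXiv:2204.13501 — 14 statements merged into one kernel-verified Lean document; each statement's English description precedes it below -/
import Mathlib

section
/- Let G be a finite directed graph with incidence matrix B : Matrix V A ℤ and let Γ : Matrix C A ℤ be an integral cycle basis matrix of G. Then the integer kernel of Γ equals the integer image of the transpose of B, i.e. {x : A → ℤ | Γ.mulVec x = 0} = {Bᵀ.mulVec π | π : V → ℤ} (equivalently, x satisfies Γ.mulVec x = 0 if and only if there is π : V → ℤ with x a = π (head a) − π (tail a) for every arc a). -/
open Matrix

/-- An integer vector orthogonal to the kernel of the matrix whose columns are the differences
`Pi.single (head a) 1 - Pi.single (tail a) 1` is a potential difference. -/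
theorem exists_potential_of_dotProduct_eq_zero
    {V A : Type*} [Fintype A] [DecidableEq V] [DecidableEq A]
    (tail head : A → V) (B : Matrix V A ℤ)
    (hB : ∀ a, B *ᵥ Pi.single a 1 = Pi.single (head a) 1 - Pi.single (tail a) 1)
    (x : A → ℤ) (hx : ∀ y, B *ᵥ y = 0 → x ⬝ᵥ y = 0) :
    ∃ π : V → ℤ, ∀ a, x a = π (head a) - π (tail a) := by
  let s : Setoid V :=
    { r := fun u v => ∃ y : A → ℤ, B *ᵥ y = Pi.single v 1 - Pi.single u 1
      iseqv :=
        { refl := fun u => ⟨0, by simp⟩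
          symm := by
            rintro u v ⟨y, hy⟩
            exact ⟨-y, by rw [mulVec_neg, hy, neg_sub]⟩
          trans := by
            rintro u v w ⟨y, hy⟩ ⟨z, hz⟩
            exact ⟨y + z, by rw [mulVec_add, hy, hz]; abel⟩ } }
  have hrep : ∀ v, ∃ y : A → ℤ,
      B *ᵥ y = Pi.single v 1 - Pi.single (Quotient.mk s v).out 1 :=
    fun v => Quotient.mk_out (s := s) v
  choose y hy using hrep
  refine ⟨fun v => x ⬝ᵥ y v, fun a => ?_⟩
  have hclass : Quotient.mk s (tail a) = Quotient.mk s (head a) :=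
    Quotient.sound ⟨Pi.single a 1, hB a⟩
  have hcycle := hx (y (tail a) + Pi.single a 1 - y (head a)) (by
    rw [mulVec_sub, mulVec_add, hy, hy, hB, hclass]
    abel)
  rw [dotProduct_sub, dotProduct_add, dotProduct_single_one] at hcycle
  linarith

theorem integral_cycle_basis_kernel_eq_image
    {V A C : Type*} [Fintype V] [Fintype A] [Fintype C] [DecidableEq V]
    (tail head : A → V) (hth : ∀ a, tail a ≠ head a)
    (B : Matrix V A ℤ)
    (hB : ∀ v a, B v a = if v = head a then 1 else if v = tail a then -1 else 0)
    (Γ : Matrix C A ℤ)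
    (hΓentries : ∀ c a, Γ c a = -1 ∨ Γ c a = 0 ∨ Γ c a = 1)
    (hΓindep : LinearIndependent ℤ (fun c : C => Γ c))
    (hΓspan : Submodule.span ℤ (Set.range fun c : C => Γ c)
      = LinearMap.ker B.mulVecLin) :
    {x : A → ℤ | Γ.mulVec x = 0} = {x : A → ℤ | ∃ π : V → ℤ, x = Bᵀ.mulVec π} := by
  classical
  have hcol : ∀ a, B *ᵥ Pi.single a 1 = Pi.single (head a) 1 - Pi.single (tail a) 1 := by
    intro a
    ext v
    have := hth a
    simp only [mulVec_single_one, col_apply, hB, Pi.sub_apply, Pi.single_apply]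
    grind
  ext x
  simp only [Set.mem_ofPred_eq]
  constructor
  · intro hx
    have horth : ∀ y, B *ᵥ y = 0 → x ⬝ᵥ y = 0 := by
      intro y hy
      have hmem : y ∈ Submodule.span ℤ (Set.range fun c : C => Γ c) := by
        rw [hΓspan]
        exact hy
      clear hy
      induction hmem using Submodule.span_induction with
      | mem z hz =>
        obtain ⟨c, rfl⟩ := hz
        rw [dotProduct_comm]
        exact congrFun hx c
      | zero => simp
      | add y z _ _ hy hz => rw [dotProduct_add, hy, hz, add_zero]
      | smul k y _ hy => rw [dotProduct_smul, hy, smul_zero]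
    obtain ⟨π, hπ⟩ := exists_potential_of_dotProduct_eq_zero tail head B hcol x horth
    refine ⟨π, funext fun a => ?_⟩
    have h : (Bᵀ *ᵥ π) a = (B *ᵥ Pi.single a 1) ⬝ᵥ π := by
      rw [mulVec_single_one]
      rfl
    rw [h, hcol, sub_dotProduct, single_one_dotProduct, single_one_dotProduct, hπ]
  · rintro ⟨π, rfl⟩
    ext c
    have hc : B *ᵥ Γ c = 0 := by
      have : Γ c ∈ LinearMap.ker B.mulVecLin := hΓspan ▸ Submodule.subset_span ⟨c, rfl⟩
      exact this
    change Γ c ⬝ᵥ (Bᵀ *ᵥ π) = 0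
    rw [dotProduct_mulVec, vecMul_transpose, hc, zero_dotProduct]
end

section
/- Let G be a finite directed graph, T : ℝ with 0 < T, and let Γ : Matrix C A ℤ be an integral cycle basis matrix of G. Then for every x : A → ℝ the following are equivalent: (1) x is a periodic tension, i.e. there exist π : V → ℝ and p : A → ℤ with x a = π (head a) − π (tail a) + T * p a for every arc a; (2) there exists z : C → ℤ with Γ.mulVec x = T • z (componentwise, where the integer entries are cast to ℝ). -/
open Matrix

/-- A `ℤ`-linear map into a divisible group which vanishes on the kernel of `f` factors
through `f`. -/
theorem exists_int_linearMap_comp_eq_of_ker_le {M N D : Type*} [AddCommGroup M] [AddCommGroup N]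
    [AddCommGroup D] [DivisibleBy D ℤ] (f : M →ₗ[ℤ] N) (g : M →ₗ[ℤ] D)
    (h : LinearMap.ker f ≤ LinearMap.ker g) : ∃ k : N →ₗ[ℤ] D, k ∘ₗ f = g := by
  obtain ⟨k, hk⟩ := (Module.Baer.of_divisible D).extension_property
    ((LinearMap.ker f).liftQ f le_rfl)
    (LinearMap.ker_eq_bot.mp (Submodule.ker_liftQ_eq_bot' _ f rfl))
    ((LinearMap.ker f).liftQ g h)
  refine ⟨k, LinearMap.ext fun m => ?_⟩
  simpa using LinearMap.congr_fun hk (Submodule.Quotient.mk m)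

/-- A column of the incidence matrix pairs a potential with its tension. -/
theorem sum_mul_incidence {V A R : Type*} [Fintype V] [DecidableEq V] [Ring R]
    {tail head : A → V} (hth : ∀ a, tail a ≠ head a) {B : Matrix V A ℤ}
    (hB : ∀ v a, B v a = if v = head a then 1 else if v = tail a then -1 else 0)
    (π : V → R) (a : A) : ∑ v, (B v a : R) * π v = π (head a) - π (tail a) := by
  have key : ∀ v, (B v a : R) * π v
      = (if v = head a then π v else 0) - (if v = tail a then π v else 0) := by
    intro v
    rw [hB]
    split_ifs with h₁ h₂
    · exact absurd (h₂.symm.trans h₁) (hth a)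
    all_goals simp
  simp [key]

theorem periodic_tension_iff_cycle_offset
    {V A C : Type*} [Fintype V] [Fintype A] [Fintype C] [DecidableEq V]
    (tail head : A → V) (hth : ∀ a, tail a ≠ head a)
    (T : ℝ) (hT : 0 < T)
    (B : Matrix V A ℤ)
    (hB : ∀ v a, B v a = if v = head a then 1 else if v = tail a then -1 else 0)
    (Γ : Matrix C A ℤ)
    (hΓentries : ∀ c a, Γ c a = -1 ∨ Γ c a = 0 ∨ Γ c a = 1)
    (hΓindep : LinearIndependent ℤ (fun c : C => Γ c))
    (hΓspan : Submodule.span ℤ (Set.range fun c : C => Γ c)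
      = LinearMap.ker B.mulVecLin)
    (x : A → ℝ) :
    (∃ (π : V → ℝ) (p : A → ℤ), ∀ a, x a = π (head a) - π (tail a) + T * p a)
      ↔ ∃ z : C → ℤ,
        (Γ.map (Int.cast : ℤ → ℝ)).mulVec x = T • fun c => (z c : ℝ) := by
  classical
  constructor
  · rintro ⟨π, p, hx⟩
    refine ⟨Γ.mulVec p, funext fun c => ?_⟩
    have hc : B.mulVec (Γ c) = 0 := by
      have : Γ c ∈ LinearMap.ker B.mulVecLin := hΓspan ▸ Submodule.subset_span ⟨c, rfl⟩
      simpa using this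
    have hπ : ∑ a, (Γ c a : ℝ) * (π (head a) - π (tail a)) = 0 := by
      simp_rw [← sum_mul_incidence hth hB π, Finset.mul_sum]
      rw [Finset.sum_comm]
      refine Finset.sum_eq_zero fun v _ => ?_
      have hv : ∑ a, (B v a : ℝ) * (Γ c a : ℝ) = 0 := by
        exact_mod_cast congrFun hc v
      calc ∑ a, (Γ c a : ℝ) * ((B v a : ℝ) * π v)
          = (∑ a, (B v a : ℝ) * (Γ c a : ℝ)) * π v := by
            rw [Finset.sum_mul]
            exact Finset.sum_congr rfl fun a _ => by ring
        _ = 0 := by rw [hv, zero_mul]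
    simp only [mulVec, dotProduct, map_apply, Pi.smul_apply, smul_eq_mul, Int.cast_sum,
      Int.cast_mul, hx, mul_add, Finset.sum_add_distrib, hπ, zero_add, Finset.mul_sum]
    exact Finset.sum_congr rfl fun a _ => by ring
  · rintro ⟨z, hz⟩
    have : Fact (0 < T) := ⟨hT⟩
    let g : (A → ℤ) →ₗ[ℤ] AddCircle T :=
      Fintype.linearCombination ℤ fun a => (x a : AddCircle T)
    have hg : LinearMap.ker B.mulVecLin ≤ LinearMap.ker g := by
      rw [← hΓspan, Submodule.span_le]
      rintro _ ⟨c, rfl⟩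
      have hc : ∑ a, Γ c a • x a = z c • T := by
        simpa [mulVec, dotProduct, mul_comm] using congrFun hz c
      have : ((∑ a, Γ c a • x a : ℝ) : AddCircle T) = 0 :=
        (AddCircle.coe_eq_zero_iff T).mpr ⟨z c, hc.symm⟩
      simpa [g, Fintype.linearCombination_apply] using this
    obtain ⟨k, hk⟩ := exists_int_linearMap_comp_eq_of_ker_le B.mulVecLin g hg
    choose π hπ using fun v => QuotientAddGroup.mk_surjective (k (Pi.single v 1))
    have hx : ∀ a, ∃ n : ℤ, n • T = x a - (π (head a) - π (tail a)) := by
      intro a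
      rw [← AddCircle.coe_eq_zero_iff]
      have hcol : B.mulVec (Pi.single a 1) = Pi.single (head a) 1 - Pi.single (tail a) 1 := by
        ext v
        have := hth a
        rw [mulVec_single_one, col_apply, hB, Pi.sub_apply, Pi.single_apply, Pi.single_apply]
        split_ifs <;> simp_all
      have ha := LinearMap.congr_fun hk (Pi.single a 1)
      rw [LinearMap.comp_apply, mulVecLin_apply, hcol, map_sub, ← hπ, ← hπ] at ha
      have hga : g (Pi.single a 1) = (x a : AddCircle T) := by
        simp [g, Fintype.linearCombination_apply_single]
      rw [AddCircle.coe_sub, AddCircle.coe_sub, ← hga, ← ha]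
      exact sub_self _
    choose p hp using hx
    refine ⟨π, p, fun a => ?_⟩
    have := hp a
    rw [zsmul_eq_mul] at this
    linarith
end

section
/- Assume additionally u a − l a < T for every arc a, let Γ : Matrix C A ℤ be an integral cycle basis matrix of G, let p p' : A → ℤ, and suppose R(p) is nonempty. Then the following are equivalent: (1) there exists q : V → ℤ such that R(p') is the translate of R(p) by T • q, i.e. R(p') = {π + T • q | π ∈ R(p)}; (2) Γ.mulVec p = Γ.mulVec p'. -/
open Matrix

/-- The region `R(p)` of timetables feasible for the periodic offset `p`. -/
def Rset {V A : Type*} (tail head : A → V) (T : ℝ) (l u : A → ℝ) (p : A → ℤ) :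
    Set (V → ℝ) :=
  {π | ∀ a, l a - T * p a ≤ π (head a) - π (tail a) ∧
      π (head a) - π (tail a) ≤ u a - T * p a}

/-- The column of the incidence matrix at the arc `a`. -/
theorem incidence_mulVec_single {V A : Type*} [Fintype A] [DecidableEq V] [DecidableEq A]
    {tail head : A → V} (hth : ∀ a, tail a ≠ head a) {B : Matrix V A ℤ}
    (hB : ∀ v a, B v a = if v = head a then 1 else if v = tail a then -1 else 0) (a : A) :
    B *ᵥ Pi.single a 1 = Pi.single (head a) 1 - Pi.single (tail a) 1 := by
  ext v
  have := hth a
  simp only [mulVec_single_one, col_apply, hB, Pi.sub_apply, Pi.single_apply]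
  grind

/-- The tension of a potential is its coboundary under the incidence matrix. -/
theorem vecMul_incidence {V A : Type*} [Fintype V] [Fintype A] [DecidableEq V]
    {tail head : A → V} (hth : ∀ a, tail a ≠ head a) {B : Matrix V A ℤ}
    (hB : ∀ v a, B v a = if v = head a then 1 else if v = tail a then -1 else 0)
    (q : V → ℤ) (a : A) : (q ᵥ* B) a = q (head a) - q (tail a) := by
  classical
  have h := dotProduct_mulVec q B (Pi.single a 1)
  rw [incidence_mulVec_single hth hB, dotProduct_sub] at h
  simpa using h.symm

/-- An integral arc vector orthogonal to all circulations is an integral tension. -/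
theorem exists_potential_of_orthogonal {V A : Type*} [Fintype A] [DecidableEq V]
    {tail head : A → V} (hth : ∀ a, tail a ≠ head a) {B : Matrix V A ℤ}
    (hB : ∀ v a, B v a = if v = head a then 1 else if v = tail a then -1 else 0)
    (x : A → ℤ) (hx : ∀ y, B *ᵥ y = 0 → y ⬝ᵥ x = 0) :
    ∃ q : V → ℤ, ∀ a, q (head a) - q (tail a) = x a := by
  classical
  let S : Setoid V :=
    { r := fun v w => ∃ y, B *ᵥ y = Pi.single v 1 - Pi.single w 1
      iseqv :=
        { refl := fun v => ⟨0, by simp⟩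
          symm := fun ⟨y, hy⟩ => ⟨-y, by rw [mulVec_neg, hy, neg_sub]⟩
          trans := fun ⟨y, hy⟩ ⟨z, hz⟩ =>
            ⟨y + z, by rw [mulVec_add, hy, hz, sub_add_sub_cancel]⟩ } }
  have key : ∀ v : V, ∃ y, B *ᵥ y =
      Pi.single v 1 - Pi.single (Quotient.mk S v).out 1 :=
    fun v => S.symm (Quotient.mk_out v)
  choose y hy using key
  refine ⟨fun v => y v ⬝ᵥ x, fun a => ?_⟩
  have hrep : Quotient.mk S (head a) = Quotient.mk S (tail a) :=
    Quotient.sound ⟨Pi.single a 1, incidence_mulVec_single hth hB a⟩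
  have h := hx (y (head a) - y (tail a) - Pi.single a 1) (by
    rw [mulVec_sub, mulVec_sub, hy, hy, incidence_mulVec_single hth hB, hrep]
    abel)
  simp only [sub_dotProduct, single_one_dotProduct] at h
  linarith

/-- Translating by `T • q` shifts the offset by the tension of `q`. -/
theorem add_mul_mem_Rset_iff {V A : Type*} {tail head : A → V} {T : ℝ} {l u : A → ℝ}
    {p p' : A → ℤ} {q : V → ℤ} (h : ∀ a, q (head a) - q (tail a) = p a - p' a) (π : V → ℝ) :
    (fun v => π v + T * q v) ∈ Rset tail head T l u p' ↔ π ∈ Rset tail head T l u p := by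
  refine forall_congr' fun a => ?_
  have ha : T * (q (head a) : ℝ) - T * q (tail a) = T * p a - T * p' a := by
    rw [← mul_sub, ← mul_sub]
    exact_mod_cast congrArg (fun n : ℤ => T * (n : ℝ)) (h a)
  constructor <;> rintro ⟨h1, h2⟩ <;> constructor <;> linarith

/-- If all spans are shorter than the period, a translate by `T • q` of a feasible timetable
determines the offset. -/
theorem tension_eq_of_mem_Rset {V A : Type*} {tail head : A → V} {T : ℝ} (hT : 0 < T)
    {l u : A → ℝ} (hspan : ∀ a, u a - l a < T) {p p' : A → ℤ} {q : V → ℤ} {π : V → ℝ}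
    (hπ : π ∈ Rset tail head T l u p)
    (hπ' : (fun v => π v + T * q v) ∈ Rset tail head T l u p') (a : A) :
    q (head a) - q (tail a) = p a - p' a := by
  obtain ⟨h1, h2⟩ := hπ a
  obtain ⟨h3, h4⟩ := hπ' a
  have hs := hspan a
  have hlt : ((q (head a) - q (tail a) - (p a - p' a) : ℤ) : ℝ) < 1 := by
    push_cast
    refine lt_of_mul_lt_mul_left ?_ hT.le
    linarith
  have hgt : (-1 : ℝ) < ((q (head a) - q (tail a) - (p a - p' a) : ℤ) : ℝ) := by
    push_cast
    refine lt_of_mul_lt_mul_left ?_ hT.le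
    linarith
  have hlt' : q (head a) - q (tail a) - (p a - p' a) < 1 := by exact_mod_cast hlt
  have hgt' : -1 < q (head a) - q (tail a) - (p a - p' a) := by exact_mod_cast hgt
  omega

theorem region_translate_iff_same_cycle_offset
    {V A C : Type*} [Fintype V] [Fintype A] [Fintype C] [DecidableEq V]
    (tail head : A → V) (hth : ∀ a, tail a ≠ head a)
    (T : ℝ) (hT : 0 < T) (l u : A → ℝ) (hlu : ∀ a, l a ≤ u a)
    (hspan : ∀ a, u a - l a < T)
    (B : Matrix V A ℤ)
    (hB : ∀ v a, B v a = if v = head a then 1 else if v = tail a then -1 else 0)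
    (Γ : Matrix C A ℤ)
    (hΓentries : ∀ c a, Γ c a = -1 ∨ Γ c a = 0 ∨ Γ c a = 1)
    (hΓindep : LinearIndependent ℤ (fun c : C => Γ c))
    (hΓspan : Submodule.span ℤ (Set.range fun c : C => Γ c)
      = LinearMap.ker B.mulVecLin)
    (p p' : A → ℤ) (hne : (Rset tail head T l u p).Nonempty) :
    (∃ q : V → ℤ,
        Rset tail head T l u p' =
          (fun π => fun v => π v + T * q v) '' Rset tail head T l u p)
      ↔ Γ.mulVec p = Γ.mulVec p' := by
  constructor
  · rintro ⟨q, hq⟩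
    obtain ⟨π, hπ⟩ := hne
    have hmem : (fun v => π v + T * q v) ∈ Rset tail head T l u p' := hq ▸ ⟨π, hπ, rfl⟩
    have htension : q ᵥ* B = p - p' := by
      ext a
      rw [vecMul_incidence hth hB]
      exact tension_eq_of_mem_Rset hT hspan hπ hmem a
    rw [← sub_eq_zero, ← mulVec_sub, ← htension]
    ext c
    have hc : B *ᵥ Γ c = 0 := by
      have : Γ c ∈ LinearMap.ker B.mulVecLin := hΓspan ▸ Submodule.subset_span ⟨c, rfl⟩
      simpa using this
    change Γ c ⬝ᵥ (q ᵥ* B) = 0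
    rw [dotProduct_comm, ← dotProduct_mulVec, hc, dotProduct_zero]
  · intro h
    rw [← sub_eq_zero, ← mulVec_sub] at h
    have horth : ∀ y, B *ᵥ y = 0 → y ⬝ᵥ (p - p') = 0 := by
      intro y hy
      have hmem : y ∈ Submodule.span ℤ (Set.range fun c : C => Γ c) := by
        rw [hΓspan]
        simpa using hy
      clear hy
      induction hmem using Submodule.span_induction with
      | mem y hy =>
        obtain ⟨c, rfl⟩ := hy
        exact congrFun h c
      | zero => exact zero_dotProduct _
      | add y z _ _ hy hz => rw [add_dotProduct, hy, hz, add_zero]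
      | smul n y _ hy => rw [smul_dotProduct, hy, smul_zero]
    obtain ⟨q, hq⟩ := exists_potential_of_orthogonal hth hB (p - p') horth
    refine ⟨q, Set.ext fun π => ⟨fun hπ => ?_, ?_⟩⟩
    · have hπq : (fun v => (π v - T * q v) + T * q v) = π := by simp
      exact ⟨fun v => π v - T * q v, (add_mul_mem_Rset_iff hq _).1 (hπq.symm ▸ hπ), hπq⟩
    · rintro ⟨ρ, hρ, rfl⟩
      exact (add_mul_mem_Rset_iff hq ρ).2 hρ
end

section
/- Assume G is weakly connected. Let π π' : V → ℝ and let x : A → ℝ be a periodic tension associated to π, i.e. there exists p : A → ℤ with x a = π (head a) − π (tail a) + T * p a for every arc a. Then x is also a periodic tension associated to π' (i.e. there exists p' : A → ℤ with x a = π' (head a) − π' (tail a) + T * p' a for all a) if and only if there exist q : V → ℤ and c : ℝ with π' v = π v + T * q v + c for every vertex v. -/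
/-- The undirected graph on `V` whose edges come from the arcs in `S`. -/
def edgeGraph {V A : Type*} (tail head : A → V) (S : Set A) : SimpleGraph V :=
  SimpleGraph.fromRel (fun v w => ∃ a ∈ S, tail a = v ∧ head a = w)

/-- An equivalence relation that relates the endpoints of every arc holds between any
two vertices of a weakly connected graph. -/
theorem rel_of_edgeGraph_connected {V A : Type*} {tail head : A → V}
    (hconn : (edgeGraph tail head (Set.univ : Set A)).Connected)
    {r : V → V → Prop} (hr : Equivalence r) (harc : ∀ a, r (tail a) (head a)) (v w : V) :
    r v w := by
  obtain ⟨walk⟩ := hconn.preconnected v w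
  induction walk with
  | nil => exact hr.refl _
  | cons hadj _ ih =>
    obtain ⟨-, ⟨a, -, rfl, rfl⟩ | ⟨a, -, rfl, rfl⟩⟩ := hadj
    · exact hr.trans (harc a) ih
    · exact hr.trans (hr.symm (harc a)) ih

theorem same_tension_iff_translate
    {V A : Type*} [Fintype V] [Fintype A]
    (tail head : A → V) (hth : ∀ a, tail a ≠ head a)
    (T : ℝ) (hT : 0 < T) (l u : A → ℝ) (hlu : ∀ a, l a ≤ u a)
    (hconn : (edgeGraph tail head (Set.univ : Set A)).Connected)
    (π π' : V → ℝ) (x : A → ℝ) (p : A → ℤ)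
    (hp : ∀ a, x a = π (head a) - π (tail a) + T * p a) :
    (∃ p' : A → ℤ, ∀ a, x a = π' (head a) - π' (tail a) + T * p' a)
      ↔ ∃ (q : V → ℤ) (c : ℝ), ∀ v, π' v = π v + T * q v + c := by
  constructor
  · rintro ⟨p', hp'⟩
    have hequiv : Equivalence fun v w => ∃ n : ℤ, (π' w - π w) - (π' v - π v) = T * n := by
      refine ⟨fun v => ⟨0, by simp⟩, ?_, ?_⟩
      · rintro v w ⟨n, hn⟩
        exact ⟨-n, by push_cast; linarith⟩
      · rintro u v w ⟨m, hm⟩ ⟨n, hn⟩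
        exact ⟨m + n, by push_cast; linarith⟩
    have harc (a : A) :
        ∃ n : ℤ, (π' (head a) - π (head a)) - (π' (tail a) - π (tail a)) = T * n :=
      ⟨p a - p' a, by push_cast; linarith [hp a, hp' a]⟩
    obtain ⟨v₀⟩ := hconn.nonempty
    choose q hq using rel_of_edgeGraph_connected hconn hequiv harc v₀
    exact ⟨q, π' v₀ - π v₀, fun v => by linarith [hq v]⟩
  · rintro ⟨q, c, h⟩
    refine ⟨fun a => p a - q (head a) + q (tail a), fun a => ?_⟩
    rw [hp a, h, h]
    push_cast
    ring
end

section
/- Assume additionally u a − l a < T for every arc a. Then the regions R(p) are pairwise disjoint: for all p p' : A → ℤ with p ≠ p', R(p) ∩ R(p') = ∅. Consequently the feasible timetable space Π is the disjoint union of the sets R(p), p : A → ℤ. -/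
/-- If every span `u a - l a` is less than the period, a timetable determines its offset. -/
theorem Rset_offset_unique {V A : Type*} {tail head : A → V} {T : ℝ} (hT : 0 < T)
    {l u : A → ℝ} (hspan : ∀ a, u a - l a < T) {p q : A → ℤ} {π : V → ℝ}
    (hp : π ∈ Rset tail head T l u p) (hq : π ∈ Rset tail head T l u q) : p = q := by
  have aux : ∀ {p q : A → ℤ}, π ∈ Rset tail head T l u p → π ∈ Rset tail head T l u q →
      ∀ a, p a ≤ q a := by
    intro p q hp hq a
    have h : T * (p a : ℝ) < T * ((q a : ℝ) + 1) := by
      linarith [(hp a).2, (hq a).1, (hp a).1, (hq a).2, hspan a]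
    exact Int.lt_add_one_iff.mp (by exact_mod_cast lt_of_mul_lt_mul_left h hT.le)
  exact funext fun a => le_antisymm (aux hp hq a) (aux hq hp a)

theorem regions_pairwise_disjoint
    {V A : Type*} [Fintype V] [Fintype A]
    (tail head : A → V) (hth : ∀ a, tail a ≠ head a)
    (T : ℝ) (hT : 0 < T) (l u : A → ℝ) (hlu : ∀ a, l a ≤ u a)
    (hspan : ∀ a, u a - l a < T) :
    (∀ p p' : A → ℤ, p ≠ p' →
        Rset tail head T l u p ∩ Rset tail head T l u p' = ∅) ∧
      ∀ π ∈ ⋃ p : A → ℤ, Rset tail head T l u p,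
        ∃! p : A → ℤ, π ∈ Rset tail head T l u p := by
  refine ⟨fun p p' hne => ?_, fun π hπ => ?_⟩
  · exact Set.eq_empty_of_forall_notMem fun π hπ =>
      hne (Rset_offset_unique hT hspan hπ.1 hπ.2)
  · obtain ⟨p, hp⟩ := Set.mem_iUnion.mp hπ
    exact ⟨p, hp, fun q hq => Rset_offset_unique hT hspan hq hp⟩
end

section
/- Assume G is weakly connected and 0 < u a − l a < T for every arc a, and let Γ : Matrix C A ℤ be an integral cycle basis matrix of G. Then the number of nonempty polytropes in the decomposition of the timetable space is at most the number of spanning trees of G: the set {z : C → ℤ | ∃ p : A → ℤ, Γ.mulVec p = z ∧ (R(p)).Nonempty} is finite, and its cardinality is at most |𝒮(G)|. -/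
open Matrix

/-- A spanning tree of the digraph, as a finite set of arcs. -/
def IsSpanningTree {V A : Type*} [Fintype V] (tail head : A → V) (S : Finset A) : Prop :=
  S.card = Fintype.card V - 1 ∧ (edgeGraph tail head (↑S : Set A)).Connected

/-- The arc `a` joins `w` to `v`, and `π v` is as small as the constraint of `a` allows
for the given value of `π w`. -/
def IsTightArc {V A : Type*} (tail head : A → V) (lo hi : A → ℝ) (π : V → ℝ)
    (a : A) (w v : V) : Prop :=
  (tail a = w ∧ head a = v ∧ π v - π w = lo a) ∨
    (head a = w ∧ tail a = v ∧ π w - π v = hi a)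

/-- On `W`, the arcs `par v` form a tree of tight arcs directed away from the root `r`,
with `d` strictly increasing along its branches. -/
def IsTightTree {V A : Type*} (tail head : A → V) (lo hi : A → ℝ) (r : V) (π : V → ℝ)
    (W : Finset V) (par : V → A) (d : V → ℕ) : Prop :=
  ∀ v ∈ W, v ≠ r → ∃ w ∈ W, d w < d v ∧ IsTightArc tail head lo hi π (par v) w v

lemma exists_crossing_arc {V A : Type*} {tail head : A → V}
    (hconn : (edgeGraph tail head (Set.univ : Set A)).Connected)
    {W : Finset V} {r x : V} (hr : r ∈ W) (hx : x ∉ W) :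
    ∃ a, ¬ (tail a ∈ W ↔ head a ∈ W) := by
  obtain ⟨p⟩ := hconn.preconnected r x
  obtain ⟨e, -, h1, h2⟩ := p.exists_boundary_dart (W : Set V) hr hx
  have h := e.adj
  simp only [edgeGraph, SimpleGraph.fromRel_adj, Set.mem_univ, true_and] at h
  obtain ⟨-, ⟨a, ha, hb⟩ | ⟨a, ha, hb⟩⟩ := h
  · exact ⟨a, by rw [ha, hb]; simp_all⟩
  · exact ⟨a, by rw [ha, hb]; simp_all⟩

lemma IsTightTree.exists_insert {V A : Type*} [Fintype A] [DecidableEq V]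
    {tail head : A → V} {lo hi : A → ℝ}
    (hconn : (edgeGraph tail head (Set.univ : Set A)).Connected)
    {r x : V} {π : V → ℝ} {W : Finset V} {par : V → A} {d : V → ℕ}
    (hr : r ∈ W) (hx : x ∉ W)
    (hπ : ∀ a, lo a ≤ π (head a) - π (tail a) ∧ π (head a) - π (tail a) ≤ hi a)
    (ht : IsTightTree tail head lo hi r π W par d) :
    ∃ (π' : V → ℝ) (v : V) (par' : V → A) (d' : V → ℕ), v ∉ W ∧
      (∀ a, lo a ≤ π' (head a) - π' (tail a) ∧ π' (head a) - π' (tail a) ≤ hi a) ∧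
      IsTightTree tail head lo hi r π' (insert v W) par' d' := by
  let slack : A → ℝ := fun a =>
    if head a ∈ W then hi a - (π (head a) - π (tail a))
    else π (head a) - π (tail a) - lo a
  obtain ⟨a₀, ha₀⟩ := exists_crossing_arc hconn hr hx
  obtain ⟨a, ha, hmin⟩ := Finset.exists_min_image
    (Finset.univ.filter fun a => ¬ (tail a ∈ W ↔ head a ∈ W)) slack ⟨a₀, by simpa using ha₀⟩
  replace ha : ¬ (tail a ∈ W ↔ head a ∈ W) := by simpa using ha
  replace hmin : ∀ b, ¬ (tail b ∈ W ↔ head b ∈ W) → slack a ≤ slack b :=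
    fun b hb => hmin b (by simpa using hb)
  have hslack : 0 ≤ slack a := by
    have := hπ a
    simp only [slack]
    split_ifs <;> linarith
  let π' : V → ℝ := fun v => if v ∈ W then π v else π v - slack a
  have hπ' : ∀ b, lo b ≤ π' (head b) - π' (tail b) ∧ π' (head b) - π' (tail b) ≤ hi b := by
    intro b
    have h1 := hπ b
    have h2 := hmin b
    by_cases hh : head b ∈ W <;> by_cases htl : tail b ∈ W
    · simpa [π', hh, htl] using h1
    · have h3 := h2 (by simp [hh, htl])
      have h4 : slack b = hi b - (π (head b) - π (tail b)) := if_pos hh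
      simp only [π', hh, htl, if_true, if_false]
      constructor <;> linarith
    · have h3 := h2 (by simp [hh, htl])
      have h4 : slack b = π (head b) - π (tail b) - lo b := if_neg hh
      simp only [π', hh, htl, if_true, if_false]
      constructor <;> linarith
    · simpa [π', hh, htl] using h1
  obtain ⟨w, v, hw, hv, hwv⟩ : ∃ w v, w ∈ W ∧ v ∉ W ∧ IsTightArc tail head lo hi π' a w v := by
    by_cases hh : head a ∈ W
    · have htl : tail a ∉ W := by tauto
      have h4 : slack a = hi a - (π (head a) - π (tail a)) := if_pos hh
      refine ⟨head a, tail a, hh, htl, Or.inr ⟨rfl, rfl, ?_⟩⟩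
      simp only [π', hh, htl, if_true, if_false]
      linarith
    · have htl : tail a ∈ W := by tauto
      have h4 : slack a = π (head a) - π (tail a) - lo a := if_neg hh
      refine ⟨tail a, head a, htl, hh, Or.inl ⟨rfl, rfl, ?_⟩⟩
      simp only [π', hh, htl, if_true, if_false]
      linarith
  refine ⟨π', v, Function.update par v a, Function.update d v (d w + 1), hv, hπ', ?_⟩
  intro y hy hyr
  have hne : ∀ z ∈ W, z ≠ v := fun z hz h => hv (h ▸ hz)
  rcases Finset.mem_insert.1 hy with rfl | hy
  · exact ⟨w, Finset.mem_insert_of_mem hw, by simp [hne w hw], by simpa using hwv⟩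
  · obtain ⟨z, hz, hd, htz⟩ := ht y hy hyr
    refine ⟨z, Finset.mem_insert_of_mem hz, by simpa [hne z hz, hne y hy] using hd, ?_⟩
    simpa [IsTightArc, π', hne y hy, hy, hz] using htz

lemma exists_isTightTree_univ {V A : Type*} [Fintype V] [Fintype A] [Nonempty A] [DecidableEq V]
    {tail head : A → V} {lo hi : A → ℝ}
    (hconn : (edgeGraph tail head (Set.univ : Set A)).Connected) (r : V)
    (hne : ∃ π : V → ℝ, ∀ a,
      lo a ≤ π (head a) - π (tail a) ∧ π (head a) - π (tail a) ≤ hi a) :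
    ∃ (π : V → ℝ) (par : V → A) (d : V → ℕ),
      (∀ a, lo a ≤ π (head a) - π (tail a) ∧ π (head a) - π (tail a) ≤ hi a) ∧
      IsTightTree tail head lo hi r π Finset.univ par d := by
  classical
  let Good : Finset V → Prop := fun W => r ∈ W ∧ ∃ (π : V → ℝ) (par : V → A) (d : V → ℕ),
      (∀ a, lo a ≤ π (head a) - π (tail a) ∧ π (head a) - π (tail a) ≤ hi a) ∧
      IsTightTree tail head lo hi r π W par d
  have h0 : Good {r} := by
    obtain ⟨π, hπ⟩ := hne
    refine ⟨by simp, π, fun _ => Classical.arbitrary A, fun _ => 0, hπ, ?_⟩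
    intro v hv hvr
    exact absurd (Finset.mem_singleton.1 hv) hvr
  obtain ⟨W, hW, hmax⟩ := Finset.exists_max_image (Finset.univ.filter Good) Finset.card
    ⟨{r}, by simpa using h0⟩
  obtain ⟨hr, π, par, d, hπ, ht⟩ : Good W := by simpa using hW
  have hWuniv : W = Finset.univ := by
    by_contra hne
    obtain ⟨x, hx⟩ : ∃ x, x ∉ W := by
      by_contra! h
      exact hne (Finset.eq_univ_iff_forall.2 h)
    obtain ⟨π', v, par', d', hv, hπ', ht'⟩ := ht.exists_insert hconn hr hx hπ
    have := hmax (insert v W) (Finset.mem_filter.2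
      ⟨Finset.mem_univ _, Finset.mem_insert_of_mem hr, π', par', d', hπ', ht'⟩)
    rw [Finset.card_insert_of_notMem hv] at this
    omega
  subst hWuniv
  exact ⟨π, par, d, hπ, ht⟩

lemma IsTightArc.eq_or_eq_swap {V A : Type*} {tail head : A → V} {lo hi lo' hi' : A → ℝ}
    {π π' : V → ℝ} {a : A} {w v w' v' : V} (h : IsTightArc tail head lo hi π a w v)
    (h' : IsTightArc tail head lo' hi' π' a w' v') :
    (w' = w ∧ v' = v) ∨ (w' = v ∧ v' = w) := by
  obtain ⟨h1, h2, -⟩ | ⟨h1, h2, -⟩ := h <;> obtain ⟨h3, h4, -⟩ | ⟨h3, h4, -⟩ := h' <;>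
    simp [← h1, ← h2, ← h3, ← h4]

lemma IsTightTree.injOn {V A : Type*} [Fintype V] {tail head : A → V} {lo hi : A → ℝ} {r : V}
    {π : V → ℝ} {par : V → A} {d : V → ℕ}
    (ht : IsTightTree tail head lo hi r π Finset.univ par d) :
    Set.InjOn par {v | v ≠ r} := by
  intro v hv v' hv' heq
  obtain ⟨w, -, hd, h⟩ := ht v (Finset.mem_univ _) hv
  obtain ⟨w', -, hd', h'⟩ := ht v' (Finset.mem_univ _) hv'
  rw [← heq] at h'
  obtain ⟨-, h2⟩ | ⟨h1, h2⟩ := h.eq_or_eq_swap h'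
  · exact h2.symm
  · subst h1 h2
    omega

lemma IsTightTree.isSpanningTree {V A : Type*} [Fintype V] [DecidableEq V] [DecidableEq A]
    {tail head : A → V} {lo hi : A → ℝ} {r : V} {π : V → ℝ} {par : V → A} {d : V → ℕ}
    (hth : ∀ a, tail a ≠ head a)
    (ht : IsTightTree tail head lo hi r π Finset.univ par d) :
    IsSpanningTree tail head ((Finset.univ.erase r).image par) := by
  constructor
  · rw [Finset.card_image_of_injOn, Finset.card_erase_of_mem (Finset.mem_univ _),
      Finset.card_univ]
    simpa [Set.InjOn] using ht.injOn
  · have key : ∀ n v, d v = n →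
        (edgeGraph tail head ↑((Finset.univ.erase r).image par)).Reachable r v := by
      intro n
      induction n using Nat.strong_induction_on with
      | _ n ih =>
        intro v hv
        by_cases hvr : v = r
        · rw [hvr]
        obtain ⟨w, -, hd, h⟩ := ht v (Finset.mem_univ _) hvr
        refine (ih (d w) (hv ▸ hd) w rfl).trans (SimpleGraph.Adj.reachable ?_)
        have hmem : par v ∈ (↑((Finset.univ.erase r).image par) : Set A) := by
          simpa using ⟨v, hvr, rfl⟩
        rw [edgeGraph, SimpleGraph.fromRel_adj]
        have := hth (par v)
        obtain ⟨h1, h2, -⟩ | ⟨h1, h2, -⟩ := h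
        · exact ⟨fun e => this (h1.trans (e.trans h2.symm)), Or.inl ⟨_, hmem, h1, h2⟩⟩
        · exact ⟨fun e => this (h2.trans (e.symm.trans h1.symm)), Or.inr ⟨_, hmem, h2, h1⟩⟩
    have : Nonempty V := ⟨r⟩
    exact ⟨fun v w => (key _ v rfl).symm.trans (key _ w rfl)⟩

/-- The arc set of a tree rooted at `r` determines the arc from each vertex to its parent. -/
lemma IsTightTree.par_eq {V A : Type*} [Fintype V] [DecidableEq V] [DecidableEq A]
    {tail head : A → V} {lo hi lo' hi' : A → ℝ} {r : V} {π π' : V → ℝ} {par par' : V → A}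
    {d d' : V → ℕ}
    (ht : IsTightTree tail head lo hi r π Finset.univ par d)
    (ht' : IsTightTree tail head lo' hi' r π' Finset.univ par' d')
    (hS : (Finset.univ.erase r).image par = (Finset.univ.erase r).image par') :
    ∀ v, v ≠ r → par v = par' v := by
  by_contra! hcon
  obtain ⟨v₀, hv₀, hne₀⟩ := hcon
  obtain ⟨v, hv, hmax⟩ := Finset.exists_max_image
    (Finset.univ.filter fun v => v ≠ r ∧ par v ≠ par' v) d ⟨v₀, by simp [hv₀, hne₀]⟩
  simp only [Finset.mem_filter, Finset.mem_univ, true_and] at hv hmax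
  obtain ⟨hvr, hne⟩ := hv
  have hmem : par' v ∈ (Finset.univ.erase r).image par := by
    rw [hS]
    exact Finset.mem_image_of_mem _ (by simp [hvr])
  obtain ⟨x, hx, hxv⟩ := Finset.mem_image.1 hmem
  have hxr : x ≠ r := Finset.ne_of_mem_erase hx
  have hxne : x ≠ v := by
    rintro rfl
    exact hne hxv
  obtain ⟨w, -, hd, h⟩ := ht x (Finset.mem_univ _) hxr
  obtain ⟨w', -, -, h'⟩ := ht' v (Finset.mem_univ _) hvr
  rw [← hxv] at h'
  obtain ⟨-, h2⟩ | ⟨-, h2⟩ := h.eq_or_eq_swap h'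
  · exact hxne h2.symm
  · subst h2
    have := hmax x ⟨hxr, fun h => hxne (ht'.injOn hxr hvr (h.symm.trans hxv))⟩
    omega

/-- Two feasible periodic offsets whose tight trees have the same arcs differ by a
coboundary. -/
lemma IsTightTree.exists_sub_eq {V A : Type*} [Fintype V] [DecidableEq V] [DecidableEq A]
    {tail head : A → V} {T : ℝ} {l u : A → ℝ} {r : V} {π π' : V → ℝ} {par par' : V → A}
    {d d' : V → ℕ} {p p' : A → ℤ} (hth : ∀ a, tail a ≠ head a) (hT : 0 < T)
    (hspan : ∀ a, u a - l a < T)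
    (hπ : π ∈ Rset tail head T l u p) (hπ' : π' ∈ Rset tail head T l u p')
    (ht : IsTightTree tail head (fun a => l a - T * p a) (fun a => u a - T * p a)
      r π Finset.univ par d)
    (ht' : IsTightTree tail head (fun a => l a - T * p' a) (fun a => u a - T * p' a)
      r π' Finset.univ par' d')
    (hS : (Finset.univ.erase r).image par = (Finset.univ.erase r).image par') :
    ∃ k : V → ℤ, ∀ a, p' a - p a = k (head a) - k (tail a) := by
  have hpar := ht.par_eq ht' hS
  have key : ∀ n v, d v = n → ∃ k : ℤ, (π v - π' v) - (π r - π' r) = T * k := by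
    intro n
    induction n using Nat.strong_induction_on with
    | _ n ih =>
      intro v hv
      by_cases hvr : v = r
      · exact ⟨0, by simp [hvr]⟩
      obtain ⟨w, -, hd, h⟩ := ht v (Finset.mem_univ _) hvr
      obtain ⟨w', -, -, h'⟩ := ht' v (Finset.mem_univ _) hvr
      rw [← hpar v hvr] at h'
      obtain ⟨k, hk⟩ := ih (d w) (hv ▸ hd) w rfl
      have hne := hth (par v)
      obtain ⟨h1, h2, h3⟩ | ⟨h1, h2, h3⟩ := h <;>
        obtain ⟨h4, h5, h6⟩ | ⟨h4, h5, h6⟩ := h'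
      · obtain rfl : w = w' := h1.symm.trans h4
        refine ⟨k + p' (par v) - p (par v), ?_⟩
        push_cast
        linarith
      · exact absurd (h5.trans h2.symm) hne
      · exact absurd (h2.trans h5.symm) hne
      · obtain rfl : w = w' := h1.symm.trans h4
        refine ⟨k + p (par v) - p' (par v), ?_⟩
        push_cast
        linarith
  choose k hk using fun v => key (d v) v rfl
  refine ⟨k, fun a => ?_⟩
  have h1 := hπ a
  have h2 := hπ' a
  have h3 := hk (head a)
  have h4 := hk (tail a)
  have h5 := hspan a
  have hlt : T * ((k (head a) - k (tail a) - (p' a - p a) : ℤ) : ℝ) < T * 1 := by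
    push_cast
    linarith
  have hgt : T * (-1) < T * ((k (head a) - k (tail a) - (p' a - p a) : ℤ) : ℝ) := by
    push_cast
    linarith
  have hlt' := lt_of_mul_lt_mul_left hlt hT.le
  have hgt' := lt_of_mul_lt_mul_left hgt hT.le
  have hlt'' : k (head a) - k (tail a) - (p' a - p a) < 1 := by exact_mod_cast hlt'
  have hgt'' : -1 < k (head a) - k (tail a) - (p' a - p a) := by exact_mod_cast hgt'
  omega

lemma mulVec_eq_of_sub_eq {V A C : Type*} [Fintype V] [Fintype A] [DecidableEq V]
    {tail head : A → V} (hth : ∀ a, tail a ≠ head a) {B : Matrix V A ℤ}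
    (hB : ∀ v a, B v a = if v = head a then 1 else if v = tail a then -1 else 0)
    {Γ : Matrix C A ℤ} (hΓ : ∀ c, B.mulVec (Γ c) = 0) {p p' : A → ℤ} {k : V → ℤ}
    (hk : ∀ a, p' a - p a = k (head a) - k (tail a)) : Γ.mulVec p = Γ.mulVec p' := by
  have hkB : p' - p = k ᵥ* B := by
    ext a
    have hterm : ∀ v, k v * B v a =
        (if v = head a then k v else 0) - (if v = tail a then k v else 0) := by
      intro v
      rw [hB]
      by_cases h1 : v = head a
      · have h2 : v ≠ tail a := fun h => hth a (h.symm.trans h1)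
        simp [h1, (hth a).symm]
      · by_cases h2 : v = tail a <;> simp [h1, h2, hth a]
    simp [Matrix.vecMul, dotProduct, hterm, hk, Finset.sum_sub_distrib]
  refine (sub_eq_zero.1 ?_).symm
  rw [← Matrix.mulVec_sub, hkB]
  ext c
  change Γ c ⬝ᵥ (k ᵥ* B) = 0
  rw [dotProduct_comm, ← Matrix.dotProduct_mulVec, hΓ c, dotProduct_zero]

theorem number_of_polytropes_le_number_of_spanning_trees
    {V A C : Type*} [Fintype V] [Fintype A] [Fintype C] [DecidableEq V]
    (tail head : A → V) (hth : ∀ a, tail a ≠ head a)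
    (T : ℝ) (hT : 0 < T) (l u : A → ℝ) (hlu : ∀ a, l a ≤ u a)
    (hconn : (edgeGraph tail head (Set.univ : Set A)).Connected)
    (hspan : ∀ a, 0 < u a - l a ∧ u a - l a < T)
    (B : Matrix V A ℤ)
    (hB : ∀ v a, B v a = if v = head a then 1 else if v = tail a then -1 else 0)
    (Γ : Matrix C A ℤ)
    (hΓentries : ∀ c a, Γ c a = -1 ∨ Γ c a = 0 ∨ Γ c a = 1)
    (hΓindep : LinearIndependent ℤ (fun c : C => Γ c))
    (hΓspan : Submodule.span ℤ (Set.range fun c : C => Γ c)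
      = LinearMap.ker B.mulVecLin) :
    {z : C → ℤ | ∃ p : A → ℤ,
        Γ.mulVec p = z ∧ (Rset tail head T l u p).Nonempty}.Finite ∧
      {z : C → ℤ | ∃ p : A → ℤ,
          Γ.mulVec p = z ∧ (Rset tail head T l u p).Nonempty}.ncard ≤
        {S : Finset A | IsSpanningTree tail head S}.ncard := by
  classical
  have hΓ : ∀ c, B.mulVec (Γ c) = 0 := by
    intro c
    have h : Γ c ∈ LinearMap.ker B.mulVecLin := by
      rw [← hΓspan]
      exact Submodule.subset_span ⟨c, rfl⟩
    simpa using h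
  obtain ⟨r⟩ := hconn.nonempty
  set Z : Set (C → ℤ) := {z | ∃ p : A → ℤ,
    Γ.mulVec p = z ∧ (Rset tail head T l u p).Nonempty} with hZ
  rcases isEmpty_or_nonempty A with hA | hA
  · have hsub : Z ⊆ {0} := by
      rintro z ⟨p, rfl, -⟩
      simp [Matrix.mulVec_eq_sum]
    have hmem : (∅ : Finset A) ∈ {S : Finset A | IsSpanningTree tail head S} := by
      have huniv : (Set.univ : Set A) = ↑(∅ : Finset A) := Subsingleton.elim _ _
      refine ⟨?_, huniv ▸ hconn⟩
      have hV : Subsingleton V := by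
        refine ⟨fun v w => ?_⟩
        by_contra hvw
        obtain ⟨a, -⟩ := exists_crossing_arc hconn (W := {v}) (r := v) (x := w)
          (by simp) (by simpa using Ne.symm hvw)
        exact hA.elim a
      have := Fintype.card_le_one_iff_subsingleton.2 hV
      simp only [Finset.card_empty]
      omega
    refine ⟨(Set.finite_singleton _).subset hsub, ?_⟩
    calc Z.ncard ≤ ({0} : Set (C → ℤ)).ncard := Set.ncard_le_ncard hsub
      _ = 1 := Set.ncard_singleton _
      _ ≤ _ := (Set.ncard_pos (Set.toFinite _)).2 ⟨∅, hmem⟩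
  have hex : ∀ z ∈ Z, ∃ (S : Finset A) (p : A → ℤ) (π : V → ℝ) (par : V → A) (d : V → ℕ),
      Γ.mulVec p = z ∧ π ∈ Rset tail head T l u p ∧
      IsTightTree tail head (fun a => l a - T * p a) (fun a => u a - T * p a)
        r π Finset.univ par d ∧ S = (Finset.univ.erase r).image par := by
    rintro z ⟨p, hp, hne⟩
    obtain ⟨π, par, d, hπ, ht⟩ := exists_isTightTree_univ
      (lo := fun a => l a - T * p a) (hi := fun a => u a - T * p a) hconn r hne
    exact ⟨_, p, π, par, d, hp, hπ, ht, rfl⟩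
  choose! f hf using hex
  have hmaps : Set.MapsTo f Z {S : Finset A | IsSpanningTree tail head S} := by
    intro z hz
    obtain ⟨p, π, par, d, -, -, ht, hS⟩ := hf z hz
    rw [hS]
    exact ht.isSpanningTree hth
  have hinj : Set.InjOn f Z := by
    intro z hz z' hz' heq
    obtain ⟨p, π, par, d, hp, hπ, ht, hS⟩ := hf z hz
    obtain ⟨p', π', par', d', hp', hπ', ht', hS'⟩ := hf z' hz'
    obtain ⟨k, hk⟩ := ht.exists_sub_eq hth hT (fun a => (hspan a).2) hπ hπ' ht'
      (hS.symm.trans (heq.trans hS'))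
    rw [← hp, ← hp']
    exact mulVec_eq_of_sub_eq hth hB hΓ hk
  exact ⟨Set.Finite.of_injOn hmaps hinj (Set.toFinite _),
    Set.ncard_le_ncard_of_injOn f hmaps hinj (Set.toFinite _)⟩
end

section
/- Let p : A → ℤ, let a₀ : A, and let k : ℤ with k ∉ {−1, 0, 1}. Define p' : A → ℤ by p' a := p a + (if a = a₀ then k else 0). Then in the limit instance R′(p) ∩ R′(p') = ∅. -/
/-- The region `R′(p)` of the limit instance (upper bounds `l + T`). -/
def Rset' {V A : Type*} (tail head : A → V) (T : ℝ) (l : A → ℝ) (p : A → ℤ) :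
    Set (V → ℝ) :=
  {π | ∀ a, l a - T * p a ≤ π (head a) - π (tail a) ∧
      π (head a) - π (tail a) ≤ l a + T - T * p a}

theorem limit_regions_far_offsets_disjoint
    {V A : Type*} [Fintype V] [Fintype A] [DecidableEq A]
    (tail head : A → V) (hth : ∀ a, tail a ≠ head a)
    (T : ℝ) (hT : 0 < T) (l u : A → ℝ) (hlu : ∀ a, l a ≤ u a)
    (p : A → ℤ) (a₀ : A) (k : ℤ) (hk : k ∉ ({-1, 0, 1} : Set ℤ)) :
    Rset' tail head T l p ∩
        Rset' tail head T l (fun a => p a + if a = a₀ then k else 0) = ∅ := by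
  refine Set.eq_empty_of_forall_notMem fun π ⟨h, h'⟩ => hk ?_
  obtain ⟨h₁, h₂⟩ := h a₀
  obtain ⟨h₃, h₄⟩ := h' a₀
  simp only [if_true, Int.cast_add, mul_add] at h₃ h₄
  have hk_le : k ≤ 1 := by
    have : (k : ℝ) ≤ 1 := le_of_mul_le_mul_left (by linarith) hT
    exact_mod_cast this
  have hk_ge : -1 ≤ k := by
    have : (-1 : ℝ) ≤ k := le_of_mul_le_mul_left (by linarith) hT
    exact_mod_cast this
  simp only [Set.mem_insert_iff, Set.mem_singleton_iff]
  lia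
end

section
/- Let p : A → ℤ and a₀ : A. Define p⁺ a := p a + (if a = a₀ then 1 else 0) and p⁻ a := p a − (if a = a₀ then 1 else 0). Then in the limit instance, R′(p) ∩ R′(p⁺) = {π ∈ R′(p) | π (head a₀) − π (tail a₀) = l a₀ − T * p a₀} (the face of R′(p) where the lower-bound inequality of a₀ is tight), and R′(p) ∩ R′(p⁻) = {π ∈ R′(p) | π (head a₀) − π (tail a₀) = l a₀ + T − T * p a₀} (the face where the upper-bound inequality of a₀ is tight). -/
theorem limit_regions_adjacent_offsets_intersect_in_face
    {V A : Type*} [Fintype V] [Fintype A] [DecidableEq A]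
    (tail head : A → V) (hth : ∀ a, tail a ≠ head a)
    (T : ℝ) (hT : 0 < T) (l u : A → ℝ) (hlu : ∀ a, l a ≤ u a)
    (p : A → ℤ) (a₀ : A) :
    Rset' tail head T l p ∩
        Rset' tail head T l (fun a => p a + if a = a₀ then 1 else 0) =
      {π ∈ Rset' tail head T l p |
        π (head a₀) - π (tail a₀) = l a₀ - T * p a₀} ∧
    Rset' tail head T l p ∩
        Rset' tail head T l (fun a => p a - if a = a₀ then 1 else 0) =
      {π ∈ Rset' tail head T l p |
        π (head a₀) - π (tail a₀) = l a₀ + T - T * p a₀} := by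
  constructor <;> ext π <;> refine and_congr_right fun h => ⟨fun h' => ?_, fun h' a => ?_⟩
  · have h₁ := h a₀
    have h₂ := h' a₀
    simp only [if_true] at h₂
    push_cast at h₂
    linarith
  · have h₁ := h a
    by_cases ha : a = a₀
    · subst ha
      simp only [if_true]
      push_cast
      constructor <;> linarith
    · simpa [ha] using h₁
  · have h₁ := h a₀
    have h₂ := h' a₀
    simp only [if_true] at h₂
    push_cast at h₂
    linarith
  · have h₁ := h a
    by_cases ha : a = a₀
    · subst ha
      simp only [if_true]
      push_cast
      constructor <;> linarith
    · simpa [ha] using h₁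
end

section
/- Assume G is weakly connected and 0 < u a − l a < T for every arc a, and let Γ : Matrix C A ℤ be an integral cycle basis matrix of G. Then the cycle offset zonotope Z contains at most as many integer points as there are spanning trees of G: the set {z : C → ℤ | ∃ x : A → ℝ, (∀ a, l a ≤ x a ∧ x a ≤ u a) ∧ Γ.mulVec x = T • z} is finite and its cardinality is at most |𝒮(G)|. -/
open Matrix

/-- `f` assigns to every vertex other than `r` an arc joining it to a vertex of smaller depth `d`,
so that the arcs in the range of `f` form a spanning tree rooted at `r`. -/
def IsParentArcMap {V A : Type*} (tail head : A → V) (r : V) (f : {v : V // v ≠ r} → A)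
    (d : V → ℕ) : Prop :=
  ∀ v, (head (f v) = v ∧ d (tail (f v)) < d v) ∨ (tail (f v) = v ∧ d (head (f v)) < d v)

namespace IsParentArcMap

variable {V A : Type*} {tail head : A → V} {r : V} {f g : {v : V // v ≠ r} → A} {d e : V → ℕ}

theorem injective (hf : IsParentArcMap tail head r f d) : Function.Injective f := by
  intro v w h
  apply Subtype.ext
  have hv := hf v
  have hw := hf w
  rw [← h] at hw
  rcases hv with ⟨h1, h2⟩ | ⟨h1, h2⟩ <;> rcases hw with ⟨h3, h4⟩ | ⟨h3, h4⟩
  · exact h1.symm.trans h3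
  · rw [h3] at h2; rw [h1] at h4; omega
  · rw [h3] at h2; rw [h1] at h4; omega
  · exact h1.symm.trans h3

/-- A rooted tree determines the parent arc of every vertex. -/
theorem eq_of_range_eq [Finite V] (hf : IsParentArcMap tail head r f d)
    (hg : IsParentArcMap tail head r g e) (h : Set.range f = Set.range g) : f = g := by
  classical
  have := Fintype.ofFinite V
  have hex : ∀ v, ∃ w, g w = f v := fun v => h.subset (Set.mem_range_self v)
  choose σ hσ using hex
  have hinj : Function.Injective σ := fun v w hvw => hf.injective (by rw [← hσ, hvw, hσ])
  have hlt : ∀ v, σ v ≠ v → d (σ v) < d v := by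
    intro v hv
    have hv' : (σ v : V) ≠ v := fun h => hv (Subtype.ext h)
    have h1 := hg (σ v)
    rw [hσ] at h1
    rcases hf v with ⟨h2, h3⟩ | ⟨h2, h3⟩ <;> rcases h1 with ⟨h4, -⟩ | ⟨h4, -⟩
    · exact absurd (h4.symm.trans h2) hv'
    · rwa [h4] at h3
    · rwa [h4] at h3
    · exact absurd (h4.symm.trans h2) hv'
  have hle : ∀ v ∈ Finset.univ, d (σ v) ≤ d v := by
    intro v _
    by_cases hv : σ v = v
    · rw [hv]
    · exact (hlt v hv).le
  have hsum : ∑ v, d (σ v) = ∑ v : {v : V // v ≠ r}, d v :=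
    (Finite.injective_iff_bijective.mp hinj).sum_comp (fun v => d v)
  have heq := (Finset.sum_eq_sum_iff_of_le hle).mp hsum
  funext v
  have hv : σ v = v := by
    by_contra hv
    exact (hlt v hv).ne (heq v (Finset.mem_univ v))
  rw [← hσ v, hv]

theorem isSpanningTree [Fintype V] [DecidableEq V] [DecidableEq A] (hth : ∀ a, tail a ≠ head a)
    (hf : IsParentArcMap tail head r f d) :
    IsSpanningTree tail head (Finset.univ.image f) := by
  refine ⟨?_, ?_⟩
  · rw [Finset.card_image_of_injective _ hf.injective, Finset.card_univ,
      Fintype.card_subtype_compl, Fintype.card_subtype_eq]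
  have key : ∀ n v, d v = n →
      (edgeGraph tail head (↑(Finset.univ.image f) : Set A)).Reachable r v := by
    intro n
    induction n using Nat.strong_induction_on with
    | _ n ih =>
      intro v hv
      by_cases hvr : v = r
      · rw [hvr]
      have hmem : f ⟨v, hvr⟩ ∈ (↑(Finset.univ.image f) : Set A) := by simp
      have hadj : (edgeGraph tail head (↑(Finset.univ.image f) : Set A)).Adj
          (tail (f ⟨v, hvr⟩)) (head (f ⟨v, hvr⟩)) :=
        (SimpleGraph.fromRel_adj _ _ _).mpr ⟨hth _, Or.inl ⟨_, hmem, rfl, rfl⟩⟩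
      rcases hf ⟨v, hvr⟩ with ⟨h1, h2⟩ | ⟨h1, h2⟩
      · have h3 := ih _ (hv ▸ h2) _ rfl
        have h4 := h3.trans hadj.reachable
        rwa [h1] at h4
      · have h3 := ih _ (hv ▸ h2) _ rfl
        have h4 := h3.trans hadj.symm.reachable
        rwa [h1] at h4
  have : Nonempty V := ⟨r⟩
  exact ⟨fun v w => (key _ v rfl).symm.trans (key _ w rfl)⟩

/-- Every vertex carries an integral flow from the root supported on the tree arcs. -/
theorem exists_path_vector [Fintype V] [Fintype A] [DecidableEq V] {B : Matrix V A ℤ}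
    (hB : ∀ a [DecidableEq A], B *ᵥ Pi.single a 1 = Pi.single (head a) 1 - Pi.single (tail a) 1)
    (hf : IsParentArcMap tail head r f d) (v : V) :
    ∃ y : A → ℤ, B *ᵥ y = Pi.single v 1 - Pi.single r 1 ∧ ∀ a, a ∉ Set.range f → y a = 0 := by
  classical
  suffices key : ∀ n v, d v = n → ∃ y : A → ℤ, B *ᵥ y = Pi.single v 1 - Pi.single r 1 ∧
      ∀ a, a ∉ Set.range f → y a = 0 from key _ v rfl
  intro n
  induction n using Nat.strong_induction_on with
  | _ n ih =>
    intro v hv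
    by_cases hvr : v = r
    · exact ⟨0, by simp [hvr], by simp⟩
    have hne : ∀ a, a ∉ Set.range f → a ≠ f ⟨v, hvr⟩ := fun a ha h => ha ⟨_, h.symm⟩
    rcases hf ⟨v, hvr⟩ with ⟨h1, h2⟩ | ⟨h1, h2⟩
    · obtain ⟨y, hy, hy0⟩ := ih _ (hv ▸ h2) _ rfl
      refine ⟨y + Pi.single (f ⟨v, hvr⟩) 1, ?_, fun a ha => ?_⟩
      · rw [mulVec_add, hy, hB, h1]; abel
      · simp [hy0 a ha, hne a ha]
    · obtain ⟨y, hy, hy0⟩ := ih _ (hv ▸ h2) _ rfl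
      refine ⟨y - Pi.single (f ⟨v, hvr⟩) 1, ?_, fun a ha => ?_⟩
      · rw [mulVec_sub, hy, hB, h1]; abel
      · simp [hy0 a ha, hne a ha]

end IsParentArcMap

theorem exists_depth_of_reflTransGen {V : Type*} {R : V → V → Prop} {r : V}
    (h : ∀ v, Relation.ReflTransGen R r v) :
    ∃ d : V → ℕ, ∀ v, v ≠ r → ∃ w, R w v ∧ d w < d v := by
  classical
  let P : ℕ → V → Prop := fun n => Nat.rec (motive := fun _ => V → Prop) (· = r) (fun _ Q v => ∃ w, Q w ∧ R w v) n
  have hP : ∀ v, ∃ n, P n v := by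
    intro v
    induction h v with
    | refl => exact ⟨0, rfl⟩
    | tail _ hbc ih =>
      obtain ⟨n, hn⟩ := ih
      exact ⟨n + 1, _, hn, hbc⟩
  refine ⟨fun v => Nat.find (hP v), fun v hv => ?_⟩
  have hs := Nat.find_spec (hP v)
  rcases hn : Nat.find (hP v) with _ | n
  · rw [hn] at hs
    exact absurd hs hv
  · rw [hn] at hs
    obtain ⟨w, hw, hR⟩ := hs
    exact ⟨w, hR, by simpa only [hn] using Nat.lt_succ_of_le (Nat.find_min' (hP w) hw)⟩

/-- Among the potential shifts of a box-feasible tension, fixed at `r`, there is one maximizing the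
sum of the potentials. -/
theorem exists_max_potential {V A : Type*} [Fintype V] {tail head : A → V}
    (hconn : (edgeGraph tail head (Set.univ : Set A)).Connected) (r : V) {l u x : A → ℝ}
    (hx : ∀ a, l a ≤ x a ∧ x a ≤ u a) :
    ∃ π : V → ℝ, π r = 0 ∧
      (∀ a, l a ≤ x a + (π (head a) - π (tail a)) ∧ x a + (π (head a) - π (tail a)) ≤ u a) ∧
      ∀ ρ : V → ℝ, ρ r = 0 →
        (∀ a, l a ≤ x a + (ρ (head a) - ρ (tail a)) ∧ x a + (ρ (head a) - ρ (tail a)) ≤ u a) →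
        ∑ v, ρ v ≤ ∑ v, π v := by
  let K : Set (V → ℝ) := {π | π r = 0 ∧
    ∀ a, l a ≤ x a + (π (head a) - π (tail a)) ∧ x a + (π (head a) - π (tail a)) ≤ u a}
  have hbound : ∀ v, ∃ b : ℝ, ∀ π ∈ K, |π v| ≤ b := by
    intro v
    obtain ⟨p⟩ := hconn.preconnected v r
    induction p with
    | nil => exact ⟨0, fun π hπ => by simp [hπ.1]⟩
    | cons hadj _ ih =>
      obtain ⟨b, hb⟩ := ih
      obtain ⟨-, ⟨a, -, h1, h2⟩ | ⟨a, -, h1, h2⟩⟩ := (SimpleGraph.fromRel_adj _ _ _).mp hadj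
      all_goals
        refine ⟨b + (u a - l a), fun π hπ => ?_⟩
        have h3 := abs_le.mp (hb π hπ)
        have h4 := hπ.2 a
        have h5 := hx a
        rw [h1, h2] at h4
        rw [abs_le]
        constructor <;> linarith
  choose b hb using hbound
  have hcl : IsClosed K := by
    have : K = {π | π r = 0} ∩ ⋂ a, {π | l a ≤ x a + (π (head a) - π (tail a)) ∧
        x a + (π (head a) - π (tail a)) ≤ u a} := by
      ext π; simp [K]
    rw [this]
    refine (isClosed_eq (continuous_apply r) continuous_const).inter
      (isClosed_iInter fun a => ?_)
    have hcont : Continuous fun π : V → ℝ => x a + (π (head a) - π (tail a)) := by fun_prop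
    exact (isClosed_le continuous_const hcont).inter (isClosed_le hcont continuous_const)
  have hcomp : IsCompact K :=
    (isCompact_univ_pi fun v => isCompact_Icc (a := -b v) (b := b v)).of_isClosed_subset hcl
      fun π hπ v _ => abs_le.mp (hb v π hπ)
  obtain ⟨π, hπ, hmax⟩ := hcomp.exists_isMaxOn ⟨0, by simpa [K] using hx⟩
    (f := fun π : V → ℝ => ∑ v, π v) (by fun_prop)
  exact ⟨π, hπ.1, hπ.2, fun ρ h1 h2 => hmax ⟨h1, h2⟩⟩

/-- A box-feasible tension can be shifted by a potential so that the tight arcs contain a spanning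
tree rooted at `r`, with arcs directed away from `r` at their upper bound and the others at their
lower bound. -/
theorem exists_tight_parentArcMap {V A : Type*} [Fintype V] [Finite A] {tail head : A → V}
    (hconn : (edgeGraph tail head (Set.univ : Set A)).Connected) (r : V) {l u x : A → ℝ}
    (hth : ∀ a, tail a ≠ head a) (hx : ∀ a, l a ≤ x a ∧ x a ≤ u a) :
    ∃ (π : V → ℝ) (f : {v : V // v ≠ r} → A) (d : V → ℕ),
      (∀ a, l a ≤ x a + (π (head a) - π (tail a)) ∧ x a + (π (head a) - π (tail a)) ≤ u a) ∧
      IsParentArcMap tail head r f d ∧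
      (∀ v, head (f v) = v → x (f v) + (π (head (f v)) - π (tail (f v))) = u (f v)) ∧
      (∀ v, tail (f v) = v → x (f v) + (π (head (f v)) - π (tail (f v))) = l (f v)) := by
  classical
  obtain ⟨π, hπr, hπ, hmax⟩ := exists_max_potential hconn r hx
  set y : A → ℝ := fun a => x a + (π (head a) - π (tail a)) with hy
  let R : V → V → Prop := fun w v => ∃ a, (tail a = w ∧ head a = v ∧ y a = u a) ∨
    (head a = w ∧ tail a = v ∧ y a = l a)
  have hreach : ∀ v, Relation.ReflTransGen R r v := by
    by_contra! hcon
    obtain ⟨v₀, hv₀⟩ := hcon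
    let c : V → ℝ := fun v => if Relation.ReflTransGen R r v then 0 else 1
    have hev : ∀ᶠ ε : ℝ in nhdsWithin 0 (Set.Ioi 0), ∀ a,
        l a ≤ y a + ε * (c (head a) - c (tail a)) ∧
          y a + ε * (c (head a) - c (tail a)) ≤ u a := by
      rw [Filter.eventually_all]
      intro a
      have hsmall : ∀ s : ℝ, 0 < s → ∀ᶠ ε : ℝ in nhdsWithin 0 (Set.Ioi 0), 0 < ε ∧ ε < s :=
        fun s hs => Ioo_mem_nhdsGT hs
      have hya := hπ a
      by_cases ht : Relation.ReflTransGen R r (tail a) <;>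
        by_cases hh : Relation.ReflTransGen R r (head a)
      · simpa [c, ht, hh] using hya
      · have hlt : y a < u a := lt_of_le_of_ne hya.2 fun h =>
          hh (ht.tail ⟨a, Or.inl ⟨rfl, rfl, h⟩⟩)
        filter_upwards [hsmall _ (sub_pos.mpr hlt)] with ε hε
        simp only [c, ht, hh, if_true, if_false]
        constructor <;> linarith [hya.1]
      · have hlt : l a < y a := lt_of_le_of_ne hya.1 fun h =>
          ht (hh.tail ⟨a, Or.inr ⟨rfl, rfl, h.symm⟩⟩)
        filter_upwards [hsmall _ (sub_pos.mpr hlt)] with ε hε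
        simp only [c, ht, hh, if_true, if_false]
        constructor <;> linarith [hya.2]
      · simpa [c, ht, hh] using hya
    obtain ⟨ε, hε, hε0⟩ := (hev.and self_mem_nhdsWithin).exists
    have hle := hmax (fun v => π v + ε * c v) (by simp [hπr, c, Relation.ReflTransGen.refl])
      fun a => by
        have h := hε a
        simp only [hy] at h
        constructor <;> linarith [h.1, h.2]
    rw [Finset.sum_add_distrib, ← Finset.mul_sum] at hle
    have hc : 0 < ∑ v, c v :=
      Finset.sum_pos' (fun v _ => by simp only [c]; split_ifs <;> norm_num)
        ⟨v₀, Finset.mem_univ _, by simp [c, hv₀]⟩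
    have := mul_pos (Set.mem_Ioi.mp hε0) hc
    linarith
  obtain ⟨d, hd⟩ := exists_depth_of_reflTransGen hreach
  have hex : ∀ v : {v : V // v ≠ r}, ∃ a, (head a = v ∧ d (tail a) < d v ∧ y a = u a) ∨
      (tail a = v ∧ d (head a) < d v ∧ y a = l a) := by
    intro v
    obtain ⟨w, ⟨a, ⟨h1, h2, h3⟩ | ⟨h1, h2, h3⟩⟩, hw⟩ := hd v v.2
    · exact ⟨a, Or.inl ⟨h2, h1 ▸ hw, h3⟩⟩
    · exact ⟨a, Or.inr ⟨h2, h1 ▸ hw, h3⟩⟩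
  choose f hf using hex
  refine ⟨π, f, d, hπ, fun v => ?_, fun v hv => ?_, fun v hv => ?_⟩
  · exact (hf v).imp (fun h => ⟨h.1, h.2.1⟩) fun h => ⟨h.1, h.2.1⟩
  · rcases hf v with h | h
    · exact h.2.2
    · exact absurd (h.1.trans hv.symm) (hth _)
  · rcases hf v with h | h
    · exact absurd (hv.trans h.1.symm) (hth _)
    · exact h.2.2

/-- If the pairings of `w` with the generators of an integral lattice lie in `T ℤ`, then so do its
pairings with all lattice vectors. -/
theorem exists_int_mul_of_mem_span {A C : Type*} [Fintype A] {Γ : C → A → ℤ} {T : ℝ}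
    {w : A → ℝ} (hw : ∀ c, ∃ k : ℤ, ∑ a, (Γ c a : ℝ) * w a = T * k) {y : A → ℤ}
    (hy : y ∈ Submodule.span ℤ (Set.range Γ)) : ∃ k : ℤ, ∑ a, (y a : ℝ) * w a = T * k := by
  induction hy using Submodule.span_induction with
  | mem y hy =>
    obtain ⟨c, rfl⟩ := hy
    exact hw c
  | zero => exact ⟨0, by simp⟩
  | add y z _ _ hy hz =>
    obtain ⟨k, hk⟩ := hy
    obtain ⟨m, hm⟩ := hz
    exact ⟨k + m, by simp [add_mul, Finset.sum_add_distrib, hk, hm, mul_add]⟩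
  | smul n y _ hy =>
    obtain ⟨k, hk⟩ := hy
    exact ⟨n * k, by simp [mul_assoc, ← Finset.mul_sum, hk]; ring⟩

theorem lattice_points_le_spanning_trees
    {V A C : Type*} [Fintype V] [Fintype A] [Fintype C] [DecidableEq V]
    (tail head : A → V) (hth : ∀ a, tail a ≠ head a)
    (T : ℝ) (hT : 0 < T) (l u : A → ℝ) (hlu : ∀ a, l a ≤ u a)
    (hconn : (edgeGraph tail head (Set.univ : Set A)).Connected)
    (hspan : ∀ a, 0 < u a - l a ∧ u a - l a < T)
    (B : Matrix V A ℤ)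
    (hB : ∀ v a, B v a = if v = head a then 1 else if v = tail a then -1 else 0)
    (Γ : Matrix C A ℤ)
    (hΓentries : ∀ c a, Γ c a = -1 ∨ Γ c a = 0 ∨ Γ c a = 1)
    (hΓindep : LinearIndependent ℤ (fun c : C => Γ c))
    (hΓspan : Submodule.span ℤ (Set.range fun c : C => Γ c)
      = LinearMap.ker B.mulVecLin) :
    {z : C → ℤ | ∃ x : A → ℝ, (∀ a, l a ≤ x a ∧ x a ≤ u a) ∧
        (Γ.map (Int.cast : ℤ → ℝ)).mulVec x = T • fun c => (z c : ℝ)}.Finite ∧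
      {z : C → ℤ | ∃ x : A → ℝ, (∀ a, l a ≤ x a ∧ x a ≤ u a) ∧
          (Γ.map (Int.cast : ℤ → ℝ)).mulVec x = T • fun c => (z c : ℝ)}.ncard ≤
        {S : Finset A | IsSpanningTree tail head S}.ncard := by
  classical
  obtain ⟨r⟩ := hconn.nonempty
  have hBsingle : ∀ a [DecidableEq A],
      B *ᵥ Pi.single a 1 = Pi.single (head a) 1 - Pi.single (tail a) 1 := by
    intro a _
    ext v
    have := hth a
    rw [mulVec_single_one, col_apply, hB]
    simp only [Pi.sub_apply, Pi.single_apply]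
    grind
  have hrow : ∀ c v, ∑ a, B v a * Γ c a = 0 := by
    intro c v
    have hmem : Γ c ∈ LinearMap.ker B.mulVecLin :=
      hΓspan ▸ Submodule.subset_span (Set.mem_range_self c)
    exact congrFun (LinearMap.mem_ker.mp hmem) v
  have hcycle : ∀ c (π : V → ℝ), ∑ a, (Γ c a : ℝ) * (π (head a) - π (tail a)) = 0 := by
    intro c π
    have hgrad : ∀ a, π (head a) - π (tail a) = ∑ v, (B v a : ℝ) * π v := by
      intro a
      have hcol : ∀ v, (B v a : ℝ) * π v =
          (if v = head a then π v else 0) - (if v = tail a then π v else 0) := by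
        intro v
        have := hth a
        rw [hB]
        split_ifs <;> simp_all
      simp [hcol, Finset.sum_sub_distrib]
    simp only [hgrad, Finset.mul_sum]
    rw [Finset.sum_comm]
    refine Finset.sum_eq_zero fun v _ => ?_
    have h : ∑ a, (B v a : ℝ) * (Γ c a : ℝ) = 0 := mod_cast hrow c v
    calc ∑ a, (Γ c a : ℝ) * ((B v a : ℝ) * π v)
        = (∑ a, (B v a : ℝ) * (Γ c a : ℝ)) * π v := by
          rw [Finset.sum_mul]
          exact Finset.sum_congr rfl fun a _ => by ring
      _ = 0 := by rw [h, zero_mul]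
  set Z : Set (C → ℤ) := {z | ∃ x : A → ℝ, (∀ a, l a ≤ x a ∧ x a ≤ u a) ∧
    (Γ.map (Int.cast : ℤ → ℝ)).mulVec x = T • fun c => (z c : ℝ)} with hZ
  have htree : ∀ z ∈ Z, ∃ S : Finset A, ∃ (x : A → ℝ) (f : {v : V // v ≠ r} → A) (d : V → ℕ),
      S = Finset.univ.image f ∧ (∀ a, l a ≤ x a ∧ x a ≤ u a) ∧
      (∀ c, ∑ a, (Γ c a : ℝ) * x a = T * z c) ∧ IsParentArcMap tail head r f d ∧
      (∀ v, head (f v) = v → x (f v) = u (f v)) ∧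
      (∀ v, tail (f v) = v → x (f v) = l (f v)) := by
    rintro z ⟨x, hx, hxz⟩
    obtain ⟨π, f, d, hπ, hf, hu, hl⟩ := exists_tight_parentArcMap hconn r hth hx
    refine ⟨_, fun a => x a + (π (head a) - π (tail a)), f, d, rfl, hπ, fun c => ?_, hf, hu, hl⟩
    have h : ∑ a, (Γ c a : ℝ) * x a = T * z c := congrFun hxz c
    simp only [mul_add, Finset.sum_add_distrib]
    rw [h, hcycle, add_zero]
  choose! F hF using htree
  have hmaps : ∀ z ∈ Z, F z ∈ {S : Finset A | IsSpanningTree tail head S} := by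
    intro z hz
    obtain ⟨x, f, d, hS, -, -, hf, -⟩ := hF z hz
    rw [hS]
    exact hf.isSpanningTree hth
  have hinj : Set.InjOn F Z := by
    intro z hz z' hz' hzz
    obtain ⟨x, f, d, hS, hx, hxz, hf, hxu, hxl⟩ := hF z hz
    obtain ⟨x', f', d', hS', hx', hxz', hf', hxu', hxl'⟩ := hF z' hz'
    rw [hS, hS', ← Finset.coe_inj, Finset.coe_image, Finset.coe_image, Finset.coe_univ,
      Set.image_univ, Set.image_univ] at hzz
    obtain rfl := hf.eq_of_range_eq hf' hzz
    have htight : ∀ v, x (f v) = x' (f v) := by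
      intro v
      rcases hf v with ⟨h, -⟩ | ⟨h, -⟩
      · rw [hxu v h, hxu' v h]
      · rw [hxl v h, hxl' v h]
    have hper : ∀ c, ∃ k : ℤ, ∑ a, (Γ c a : ℝ) * (x a - x' a) = T * k := fun c =>
      ⟨z c - z' c, by
        push_cast
        rw [mul_sub, ← hxz, ← hxz', ← Finset.sum_sub_distrib]
        exact Finset.sum_congr rfl fun a _ => by ring⟩
    have hxx : ∀ a, x a = x' a := by
      intro a
      obtain ⟨p, hp, hp0⟩ := hf.exists_path_vector hBsingle (tail a)
      obtain ⟨q, hq, hq0⟩ := hf.exists_path_vector hBsingle (head a)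
      have hker : Pi.single a 1 + p - q ∈ LinearMap.ker B.mulVecLin := by
        rw [LinearMap.mem_ker, mulVecLin_apply, mulVec_sub, mulVec_add, hp, hq, hBsingle]
        abel
      rw [← hΓspan] at hker
      obtain ⟨k, hk⟩ := exists_int_mul_of_mem_span hper hker
      have hsum : ∑ b, ((Pi.single a 1 + p - q : A → ℤ) b : ℝ) * (x b - x' b) = x a - x' a := by
        rw [Finset.sum_eq_single_of_mem a (Finset.mem_univ a)]
        · by_cases ha : a ∈ Set.range f
          · obtain ⟨v, rfl⟩ := ha
            simp [htight v]
          · simp [hp0 a ha, hq0 a ha]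
        · intro b _ hba
          by_cases hb : b ∈ Set.range f
          · obtain ⟨v, rfl⟩ := hb
            simp [htight v]
          · simp [hp0 b hb, hq0 b hb, hba]
      rw [hsum] at hk
      have h1 := hx a
      have h2 := hx' a
      have h3 := (hspan a).2
      have hk1 : (k : ℝ) < 1 := by
        by_contra! h
        nlinarith
      have hk2 : (-1 : ℝ) < k := by
        by_contra! h
        nlinarith
      have hk0 : k = 0 := by
        have h4 : k < 1 := mod_cast hk1
        have h5 : -1 < k := mod_cast hk2
        omega
      rw [hk0] at hk
      simpa [sub_eq_zero] using hk
    funext c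
    have h : T * (z c : ℝ) = T * z' c := by
      rw [← hxz, ← hxz']
      simp only [hxx]
    exact_mod_cast mul_left_cancel₀ hT.ne' h
  exact ⟨Set.Finite.of_injOn hmaps hinj (Set.toFinite _),
    Set.ncard_le_ncard_of_injOn F hmaps hinj (Set.toFinite _)⟩
end

section
/- Let Γ : Matrix C A ℤ be an integral cycle basis matrix of G. Then for every z : C → ℤ the following are equivalent: (1) z is an integer point of the cycle offset zonotope, i.e. there exists x : A → ℝ with l a ≤ x a ≤ u a for all a and Γ.mulVec x = T • z; (2) there exists p : A → ℤ with Γ.mulVec p = z and R(p) nonempty. Hence z ↦ R-polytrope of z is a bijection between integer points of Z and nonempty polytropes of the timetable decomposition. -/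
open Matrix

/-- A `ℤ`-valued linear functional on the kernel of a map into a finitely generated
torsion-free module over `ℤ` extends to the whole domain. -/
theorem exists_extend_of_ker {M N P : Type*} [AddCommGroup M] [AddCommGroup N] [AddCommGroup P]
    [Module.Finite ℤ N] [Module.IsTorsionFree ℤ N] (f : M →ₗ[ℤ] N) (g : LinearMap.ker f →ₗ[ℤ] P) :
    ∃ h : M →ₗ[ℤ] P, ∀ x : LinearMap.ker f, h x = g x := by
  obtain ⟨s, hs⟩ := Module.projective_lifting_property f.rangeRestrict LinearMap.id
    f.surjective_rangeRestrict
  have hs' : ∀ y, f (s y) = y := fun y => congrArg Subtype.val (LinearMap.congr_fun hs y)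
  let q : M →ₗ[ℤ] LinearMap.ker f :=
    (LinearMap.id - s ∘ₗ f.rangeRestrict).codRestrict _ fun x => by simp [hs']
  refine ⟨g ∘ₗ q, fun x => congrArg g (Subtype.ext ?_)⟩
  have hx : f.rangeRestrict x = 0 := Subtype.ext x.2
  simp [q, hx]

/-- A matrix whose rows form a `ℤ`-basis of the kernel of an integer matrix is surjective on
integer vectors. -/
theorem exists_mulVec_eq_of_span_eq_ker {V A C : Type*} [Finite V] [Fintype A]
    (B : Matrix V A ℤ) (Γ : Matrix C A ℤ)
    (hindep : LinearIndependent ℤ (fun c : C => Γ c))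
    (hspan : Submodule.span ℤ (Set.range fun c : C => Γ c) = LinearMap.ker B.mulVecLin)
    (z : C → ℤ) : ∃ p : A → ℤ, Γ.mulVec p = z := by
  classical
  obtain ⟨h, hh⟩ := exists_extend_of_ker B.mulVecLin
    ((Module.Basis.span hindep).constr ℤ z ∘ₗ (LinearEquiv.ofEq _ _ hspan).symm.toLinearMap)
  refine ⟨fun a => h fun j => if a = j then 1 else 0, funext fun c => ?_⟩
  have hc : Γ c ∈ LinearMap.ker B.mulVecLin := hspan ▸ Submodule.subset_span ⟨c, rfl⟩
  have hb : (LinearEquiv.ofEq _ _ hspan).symm ⟨Γ c, hc⟩ = Module.Basis.span hindep c :=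
    Subtype.ext (congrArg Subtype.val (Module.Basis.span_apply hindep c).symm)
  calc Γ.mulVec (fun a => h fun j => if a = j then 1 else 0) c = h (Γ c) := by
        rw [LinearMap.pi_apply_eq_sum_univ h (Γ c)]
        simp [Matrix.mulVec, dotProduct]
    _ = z c := by
        rw [hh ⟨Γ c, hc⟩, LinearMap.comp_apply, LinearEquiv.coe_coe, hb, Module.Basis.constr_basis]

/-- A real vector orthogonal to the integer kernel of an integer matrix lies in its real row
space. -/
theorem exists_sum_mul_eq_of_ker {V A : Type*} [Fintype V] [Fintype A]
    (B : Matrix V A ℤ) (y : A → ℝ)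
    (hy : ∀ k ∈ LinearMap.ker B.mulVecLin, ∑ a, (k a : ℝ) * y a = 0) :
    ∃ π : V → ℝ, ∀ a, ∑ v, (B v a : ℝ) * π v = y a := by
  classical
  let φ : (A → ℤ) →ₗ[ℤ] ℝ := Fintype.linearCombination ℤ y
  have hφ : ∀ k, φ k = ∑ a, (k a : ℝ) * y a := fun k => by
    simp [φ, Fintype.linearCombination_apply]
  have hker : LinearMap.ker B.mulVecLin ≤ LinearMap.ker φ := fun k hk => by
    rw [LinearMap.mem_ker, hφ, hy k hk]
  obtain ⟨g, hg⟩ := (Module.Baer.of_divisible ℝ).extension_property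
    ((LinearMap.ker B.mulVecLin).liftQ B.mulVecLin le_rfl)
    (LinearMap.ker_eq_bot.mp (Submodule.ker_liftQ_eq_bot _ _ _ le_rfl))
    ((LinearMap.ker B.mulVecLin).liftQ φ hker)
  have hg' : ∀ k, g (B.mulVec k) = φ k := fun k => by
    simpa using LinearMap.congr_fun hg (Submodule.Quotient.mk k)
  refine ⟨fun v => g fun j => if v = j then 1 else 0, fun a => ?_⟩
  have h := hg' (Pi.single a 1)
  rw [hφ, Matrix.mulVec_single_one, LinearMap.pi_apply_eq_sum_univ g] at h
  simpa [Pi.single_apply] using h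

theorem lattice_point_iff_nonempty_polytrope
    {V A C : Type*} [Fintype V] [Fintype A] [Fintype C] [DecidableEq V]
    (tail head : A → V) (hth : ∀ a, tail a ≠ head a)
    (T : ℝ) (hT : 0 < T) (l u : A → ℝ) (hlu : ∀ a, l a ≤ u a)
    (B : Matrix V A ℤ)
    (hB : ∀ v a, B v a = if v = head a then 1 else if v = tail a then -1 else 0)
    (Γ : Matrix C A ℤ)
    (hΓentries : ∀ c a, Γ c a = -1 ∨ Γ c a = 0 ∨ Γ c a = 1)
    (hΓindep : LinearIndependent ℤ (fun c : C => Γ c))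
    (hΓspan : Submodule.span ℤ (Set.range fun c : C => Γ c)
      = LinearMap.ker B.mulVecLin)
    (z : C → ℤ) :
    (∃ x : A → ℝ, (∀ a, l a ≤ x a ∧ x a ≤ u a) ∧
        (Γ.map (Int.cast : ℤ → ℝ)).mulVec x = T • fun c => (z c : ℝ))
      ↔ ∃ p : A → ℤ, Γ.mulVec p = z ∧ (Rset tail head T l u p).Nonempty := by
  have hrow : ∀ c, Γ c ∈ LinearMap.ker B.mulVecLin := fun c =>
    hΓspan ▸ Submodule.subset_span ⟨c, rfl⟩
  have hcob : ∀ (π : V → ℝ) a, ∑ v, (B v a : ℝ) * π v = π (head a) - π (tail a) := by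
    intro π a
    have hterm : ∀ v, (B v a : ℝ) * π v =
        (if v = head a then π v else 0) - (if v = tail a then π v else 0) := by
      intro v
      have := hth a
      rw [hB]
      split_ifs <;> simp_all
    simp [hterm, Finset.sum_sub_distrib]
  constructor
  · rintro ⟨x, hx, hΓx⟩
    obtain ⟨p, hp⟩ := exists_mulVec_eq_of_span_eq_ker B Γ hΓindep hΓspan z
    obtain ⟨π, hπ⟩ := exists_sum_mul_eq_of_ker B (fun a => x a - T * p a) (by
      intro k hk
      rw [← hΓspan] at hk
      induction hk using Submodule.span_induction with
      | mem k hk =>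
        obtain ⟨c, rfl⟩ := hk
        have h₁ : ∑ a, (Γ c a : ℝ) * x a = T * z c := congrFun hΓx c
        have h₂ : ∑ a, (Γ c a : ℝ) * p a = z c := by
          exact_mod_cast congrFun hp c
        simp only [mul_sub, Finset.sum_sub_distrib, mul_left_comm _ T, ← Finset.mul_sum, h₁, h₂,
          sub_self]
      | zero => simp
      | add k k' _ _ h h' => simp [add_mul, Finset.sum_add_distrib, h, h']
      | smul n k _ h => simp [mul_assoc, ← Finset.mul_sum, h])
    refine ⟨p, hp, π, fun a => ?_⟩
    rw [← hcob, hπ]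
    exact ⟨sub_le_sub_right (hx a).1 _, sub_le_sub_right (hx a).2 _⟩
  · rintro ⟨p, rfl, π, hπ⟩
    refine ⟨fun a => ∑ v, (B v a : ℝ) * π v + T * p a, fun a => ?_, funext fun c => ?_⟩
    · beta_reduce
      rw [hcob]
      constructor <;> linarith [hπ a]
    · have hz : ∀ v, ∑ a, (B v a : ℝ) * Γ c a = 0 := fun v => by
        exact_mod_cast congrFun (hrow c) v
      have hcomm : ∑ a, (Γ c a : ℝ) * ∑ v, (B v a : ℝ) * π v = 0 := by
        simp only [Finset.mul_sum]
        rw [Finset.sum_comm]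
        refine Finset.sum_eq_zero fun v _ => ?_
        rw [← zero_mul (π v), ← hz v, Finset.sum_mul]
        exact Finset.sum_congr rfl fun a _ => by ring
      simp only [Matrix.mulVec, dotProduct, Matrix.map_apply, Pi.smul_apply, smul_eq_mul, mul_add,
        Finset.sum_add_distrib, hcomm, zero_add, mul_left_comm _ T, ← Finset.mul_sum]
      push_cast
      rfl
end

section
/- Fix a vertex i : V. If F ⊆ (A → ℝ) is a bounded set (Bornology.IsBounded) that is an exposed face of P_i (IsExposed ℝ P_i F), then F is an exposed face of the hyperrectangle X_LP (IsExposed ℝ X_LP F). -/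
open Pointwise
/-- The real incidence row of a vertex `v`. -/
def incRow {V A : Type*} [DecidableEq V] (tail head : A → V) (v : V) : A → ℝ :=
  fun a => if v = head a then 1 else if v = tail a then -1 else 0

/-- The cone generated by the incidence rows of all vertices except `i`. -/
def coneKi {V A : Type*} [Fintype V] [DecidableEq V] (tail head : A → V) (i : V) :
    Set (A → ℝ) :=
  {y | ∃ lam : V → ℝ, (∀ v, 0 ≤ lam v) ∧ lam i = 0 ∧
    y = ∑ v : V, lam v • incRow tail head v}

/-- The fractional tension polytope (a hyperrectangle). -/
def XLP {A : Type*} (l u : A → ℝ) : Set (A → ℝ) :=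
  {x | ∀ a, l a ≤ x a ∧ x a ≤ u a}

/-- A bounded exposed face of the sum of a set and a cone lies in the set. -/
theorem IsExposed.subset_of_isBounded_of_add_cone {E : Type*} [NormedAddCommGroup E]
    [NormedSpace ℝ E] {S C F : Set E} (hC : ∀ t : ℝ, 0 ≤ t → ∀ y ∈ C, t • y ∈ C)
    (hF : IsExposed ℝ (S + C) F) (hbdd : Bornology.IsBounded F) : F ⊆ S := by
  intro x hx
  obtain ⟨g, rfl⟩ := hF ⟨x, hx⟩
  obtain ⟨⟨p, hp, y, hy, rfl⟩, hmax⟩ := hx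
  have hray : ∀ t : ℝ, 0 ≤ t → p + t • y ∈ S + C := fun t ht =>
    Set.add_mem_add hp (hC t ht y hy)
  have hgy : g y = 0 := by
    have h₀ := hmax _ (hray 0 le_rfl)
    have h₂ := hmax _ (hray 2 zero_le_two)
    simp only [map_add, map_smul, smul_eq_mul] at h₀ h₂
    linarith
  obtain ⟨R, hR⟩ := hbdd.exists_norm_le
  have hbound : ∀ t : ℝ, 0 ≤ t → t * ‖y‖ ≤ R + ‖p‖ := by
    intro t ht
    have hmem : ‖p + t • y‖ ≤ R := by
      refine hR _ ⟨hray t ht, fun z hz => ?_⟩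
      simpa [hgy] using hmax z hz
    have htri := norm_sub_le (p + t • y) p
    rw [add_sub_cancel_left, norm_smul, Real.norm_of_nonneg ht] at htri
    linarith
  have hy₀ : y = 0 := by
    by_contra hne
    have hpos : 0 < ‖y‖ := norm_pos_iff.mpr hne
    have hnonneg : 0 ≤ R + ‖p‖ := by simpa using hbound 0 le_rfl
    have h := hbound ((R + ‖p‖ + 1) / ‖y‖) (by positivity)
    rw [div_mul_cancel₀ _ hpos.ne'] at h
    linarith
  simpa [hy₀] using hp

theorem smul_mem_coneKi {V A : Type*} [Fintype V] [DecidableEq V] (tail head : A → V) (i : V)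
    (t : ℝ) (ht : 0 ≤ t) (y : A → ℝ) (hy : y ∈ coneKi tail head i) :
    t • y ∈ coneKi tail head i := by
  obtain ⟨lam, hlam, hi, rfl⟩ := hy
  refine ⟨fun v => t * lam v, fun v => mul_nonneg ht (hlam v), by simp [hi], ?_⟩
  simp [Finset.smul_sum, mul_smul]

theorem zero_mem_coneKi {V A : Type*} [Fintype V] [DecidableEq V] (tail head : A → V) (i : V) :
    (0 : A → ℝ) ∈ coneKi tail head i :=
  ⟨0, by simp, rfl, by simp⟩

theorem bounded_exposed_face_of_Pi_is_face_of_XLP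
    {V A : Type*} [Fintype V] [Fintype A] [DecidableEq V]
    (tail head : A → V) (hth : ∀ a, tail a ≠ head a)
    (T : ℝ) (hT : 0 < T) (l u : A → ℝ) (hlu : ∀ a, l a ≤ u a)
    (i : V) (F : Set (A → ℝ))
    (hFbdd : Bornology.IsBounded F)
    (hFexp : IsExposed ℝ (XLP l u + coneKi tail head i) F) :
    IsExposed ℝ (XLP l u) F := by
  exact hFexp.mono (Set.subset_add_left _ (zero_mem_coneKi tail head i))
    (hFexp.subset_of_isBounded_of_add_cone (smul_mem_coneKi tail head i) hFbdd)
end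

section
/- Assume G is weakly connected and l a < u a for every arc a, and fix i : V. Let L, U ⊆ A be disjoint sets of arcs and let F_{L,U} := {x : A → ℝ | (∀ a, l a ≤ x a ∧ x a ≤ u a) ∧ (∀ a ∈ L, x a = l a) ∧ (∀ a ∈ U, x a = u a)}. If F_{L,U} is nonempty and is an exposed face of P_i (IsExposed ℝ P_i F_{L,U}), then the structure (L ∪ U, L, U) is spanning: the undirected graph on V with edge set {{tail a, head a} | a ∈ L ∪ U} is connected (in particular it reaches every vertex of G). -/
open Pointwise

/-- The sum of the incidence rows over `C` counts, for every arc, entering minus leaving `C`. -/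
theorem sum_indicator_smul_incRow {V A : Type*} [Fintype V] [DecidableEq V]
    (tail head : A → V) (hth : ∀ a, tail a ≠ head a) (C : Set V) (a : A) :
    (∑ v : V, C.indicator (1 : V → ℝ) v • incRow tail head v) a =
      C.indicator (1 : V → ℝ) (head a) - C.indicator (1 : V → ℝ) (tail a) := by
  have hrow : ∀ v, C.indicator (1 : V → ℝ) v * incRow tail head v a =
      (if v = head a then C.indicator (1 : V → ℝ) v else 0) -
        (if v = tail a then C.indicator (1 : V → ℝ) v else 0) := by
    intro v
    have := hth a
    unfold incRow
    split_ifs with h1 h2 <;> simp_all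
  simp [Finset.sum_apply, hrow, Finset.sum_sub_distrib]

/-- A finite family of nondegenerate intervals has a common positive lower bound on its
radii. -/
theorem exists_pos_forall_two_mul_le_sub {A : Type*} [Finite A] (l u : A → ℝ)
    (hlu : ∀ a, l a < u a) : ∃ ε : ℝ, 0 < ε ∧ ∀ a, 2 * ε ≤ u a - l a := by
  rcases isEmpty_or_nonempty A with hA | hA
  · exact ⟨1, one_pos, fun a => hA.elim a⟩
  · obtain ⟨b, hb⟩ := Finite.exists_min (fun a => u a - l a)
    refine ⟨(u b - l b) / 2, by linarith [hlu b], fun a => ?_⟩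
    have := hb a
    linarith

/-- Both endpoints of an arc in `S` lie in the same reachability classes of `edgeGraph`. -/
theorem reachable_head_iff_reachable_tail {V A : Type*} (tail head : A → V)
    (hth : ∀ a, tail a ≠ head a) (S : Set A) (i : V) {a : A} (ha : a ∈ S) :
    (edgeGraph tail head S).Reachable i (head a) ↔
      (edgeGraph tail head S).Reachable i (tail a) := by
  have hadj : (edgeGraph tail head S).Adj (tail a) (head a) :=
    (SimpleGraph.fromRel_adj _ _ _).2 ⟨hth a, Or.inl ⟨a, ha, rfl, rfl⟩⟩
  exact ⟨fun h => h.trans hadj.symm.reachable, fun h => h.trans hadj.reachable⟩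

theorem bounded_face_of_Pi_is_spanning_structure
    {V A : Type*} [Fintype V] [Fintype A] [DecidableEq V]
    (tail head : A → V) (hth : ∀ a, tail a ≠ head a)
    (T : ℝ) (hT : 0 < T) (l u : A → ℝ) (hlu : ∀ a, l a < u a)
    (hconn : (edgeGraph tail head (Set.univ : Set A)).Connected)
    (i : V) (L U : Set A) (hLU : Disjoint L U)
    (hne : {x : A → ℝ | (∀ a, l a ≤ x a ∧ x a ≤ u a) ∧
        (∀ a ∈ L, x a = l a) ∧ (∀ a ∈ U, x a = u a)}.Nonempty)
    (hexp : IsExposed ℝ (XLP l u + coneKi tail head i)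
      {x : A → ℝ | (∀ a, l a ≤ x a ∧ x a ≤ u a) ∧
        (∀ a ∈ L, x a = l a) ∧ (∀ a ∈ U, x a = u a)}) :
    (edgeGraph tail head (L ∪ U)).Connected := by
  classical
  let G := edgeGraph tail head (L ∪ U)
  have := hconn.nonempty
  suffices hreach : ∀ v, G.Reachable i v from
    ⟨fun v w => (hreach v).symm.trans (hreach w)⟩
  by_contra! hex
  obtain ⟨w, hw⟩ := hex
  let C : Set V := {v | ¬ G.Reachable i v}
  have hiC : i ∉ C := fun h => h (SimpleGraph.Reachable.refl i)
  set y : A → ℝ := ∑ v : V, C.indicator (1 : V → ℝ) v • incRow tail head v with hy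
  have hya : ∀ a, y a = C.indicator (1 : V → ℝ) (head a) - C.indicator (1 : V → ℝ) (tail a) :=
    sum_indicator_smul_incRow tail head hth C
  have hyabs : ∀ a, -1 ≤ y a ∧ y a ≤ 1 := by
    intro a
    rw [hya]
    by_cases h1 : head a ∈ C <;> by_cases h2 : tail a ∈ C <;> simp [h1, h2]
  have hy0 : ∀ a ∈ L ∪ U, y a = 0 := by
    intro a ha
    have hiff : head a ∈ C ↔ tail a ∈ C :=
      not_congr (reachable_head_iff_reachable_tail tail head hth _ i ha)
    rw [hya]
    by_cases h : tail a ∈ C <;> simp [hiff, h]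
  have hcone : ∀ t : ℝ, 0 ≤ t → t • y ∈ coneKi tail head i := by
    intro t ht
    refine ⟨fun v => t * C.indicator (1 : V → ℝ) v, fun v => ?_, by simp [hiC], ?_⟩
    · exact mul_nonneg ht (Set.indicator_nonneg (fun _ _ => zero_le_one) v)
    · simp [hy, Finset.smul_sum, mul_smul]
  obtain ⟨a, ha⟩ : ∃ a, y a = 1 ∨ y a = -1 := by
    obtain ⟨p⟩ := hconn.preconnected w i
    obtain ⟨d, -, hd1, hd2⟩ := p.exists_boundary_dart C hw hiC
    obtain ⟨-, ⟨a, -, h1, h2⟩ | ⟨a, -, h1, h2⟩⟩ := (SimpleGraph.fromRel_adj _ _ _).1 d.adj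
    · exact ⟨a, Or.inr (by rw [hya, h1, h2]; simp [hd1, hd2])⟩
    · exact ⟨a, Or.inl (by rw [hya, h1, h2]; simp [hd1, hd2])⟩
  obtain ⟨ε, hε, hεlu⟩ := exists_pos_forall_two_mul_le_sub l u hlu
  obtain ⟨z, hz, hzL, hzU⟩ := hne
  obtain ⟨f, hf⟩ := hexp ⟨z, hz, hzL, hzU⟩
  let x : A → ℝ := fun a => if a ∈ L ∪ U then z a else (l a + u a) / 2
  have hmem : ∀ t : ℝ, 0 ≤ t → t ≤ ε →
      x + t • y ∈ {x : A → ℝ | (∀ a, l a ≤ x a ∧ x a ≤ u a) ∧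
        (∀ a ∈ L, x a = l a) ∧ (∀ a ∈ U, x a = u a)} := by
    intro t ht htε
    have hfix : ∀ b ∈ L ∪ U, (x + t • y) b = z b := fun b hb => by
      simp only [Pi.add_apply, Pi.smul_apply, hy0 b hb, smul_zero, add_zero, x, if_pos hb]
    refine ⟨fun b => ?_, fun b hb => ?_, fun b hb => ?_⟩
    · by_cases hb : b ∈ L ∪ U
      · rw [hfix b hb]
        exact hz b
      · simp only [Pi.add_apply, Pi.smul_apply, smul_eq_mul, x, if_neg hb]
        have := hεlu b
        have := hyabs b
        constructor <;> nlinarith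
    · rw [hfix b (Or.inl hb), hzL b hb]
    · rw [hfix b (Or.inr hb), hzU b hb]
  have hx := hmem 0 le_rfl hε.le
  have hx' := hmem ε hε.le le_rfl
  rw [zero_smul, add_zero] at hx
  have hxX : x ∈ XLP l u := hx.1
  rw [hf] at hx hx'
  have hfy : f y = 0 := by
    have h1 := hx.2 _ hx'.1
    have h2 := hx'.2 _ hx.1
    simp only [map_add, map_smul, smul_eq_mul] at h1 h2
    have : ε * f y = 0 := by linarith
    exact (mul_eq_zero.1 this).resolve_left hε.ne'
  have ht : 0 ≤ u a - l a + 1 := by linarith [hlu a]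
  have hfar : x + (u a - l a + 1) • y ∈ {x : A → ℝ | (∀ a, l a ≤ x a ∧ x a ≤ u a) ∧
        (∀ a ∈ L, x a = l a) ∧ (∀ a ∈ U, x a = u a)} := by
    rw [hf]
    refine ⟨Set.add_mem_add hxX (hcone _ ht), fun q hq => ?_⟩
    simpa [hfy] using hx.2 q hq
  have h1 := hfar.1 a
  have h2 := hxX a
  simp only [Pi.add_apply, Pi.smul_apply, smul_eq_mul] at h1
  rcases ha with ha | ha <;> rw [ha] at h1 <;> linarith
end

section
/- Let G be a finite directed graph, let Γ : Matrix C A ℤ be an integral cycle basis matrix of G, and let d : A → ℝ with d a ≥ 0 for all a. Then ∑_{S ∈ 𝒮(G)} ∏_{a ∈ A \ S} d a ≤ ∏_{c ∈ C} ∑_{a : Γ c a ≠ 0} d a, where the sum on the left is over all spanning trees S of G and the product on the left over all arcs not in S. -/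
open Matrix

section SpanningTreeCycleBasis

variable {V A C : Type*} [Fintype A] [Fintype C] [DecidableEq V] [DecidableEq A]
  {tail head : A → V} {B : Matrix V A ℤ}

/-- Two vertices joined inside `S` are joined by an integral unit flow supported on `S`. -/
theorem exists_unit_flow_of_reachable
    (hcol : ∀ a, B *ᵥ Pi.single a 1 = Pi.single (head a) 1 - Pi.single (tail a) 1)
    {S : Set A} {v w : V} (h : (edgeGraph tail head S).Reachable v w) :
    ∃ z : A → ℤ, (∀ a ∉ S, z a = 0) ∧ B *ᵥ z = Pi.single w 1 - Pi.single v 1 := by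
  obtain ⟨p⟩ := h
  induction p with
  | nil => exact ⟨0, by simp, by simp⟩
  | @cons u v w huv p ih =>
    obtain ⟨z, hz, hBz⟩ := ih
    obtain ⟨-, ⟨a, ha, rfl, rfl⟩ | ⟨a, ha, rfl, rfl⟩⟩ := (SimpleGraph.fromRel_adj _ _ _).1 huv
    · refine ⟨z + Pi.single a 1, fun b hb => ?_, ?_⟩
      · simp [hz b hb, Pi.single_eq_of_ne (ne_of_mem_of_not_mem ha hb).symm]
      · rw [mulVec_add, hBz, hcol]; abel
    · refine ⟨z - Pi.single a 1, fun b hb => ?_, ?_⟩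
      · simp [hz b hb, Pi.single_eq_of_ne (ne_of_mem_of_not_mem ha hb).symm]
      · rw [mulVec_sub, hBz, hcol]; abel

/-- The cycle space of a connected graph has rank `|A| - |V| + 1`. -/
theorem finrank_ker_add_card_of_connected [Fintype V]
    (hcol : ∀ a, B *ᵥ Pi.single a 1 = Pi.single (head a) 1 - Pi.single (tail a) 1)
    {S : Set A} (h : (edgeGraph tail head S).Connected) :
    Module.finrank ℤ (LinearMap.ker B.mulVecLin) + Fintype.card V = Fintype.card A + 1 := by
  obtain ⟨r⟩ := h.nonempty
  let total : (V → ℤ) →ₗ[ℤ] ℤ := ∑ v, LinearMap.proj v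
  have htotal (x : V → ℤ) : total x = ∑ v, x v := by simp [total]
  have htotalB : total ∘ₗ B.mulVecLin = 0 := by
    refine LinearMap.pi_ext' fun a => LinearMap.ext_ring ?_
    simp only [LinearMap.coe_comp, Function.comp_apply, LinearMap.coe_single, mulVecLin_apply,
      hcol, htotal]
    simp [Finset.sum_sub_distrib]
  have hrange : LinearMap.range B.mulVecLin = LinearMap.ker total := by
    refine le_antisymm (LinearMap.range_le_ker_iff.2 htotalB) fun x hx => ?_
    have hx0 : ∑ v, x v = 0 := by rw [← htotal]; exact hx
    have hsum : x = ∑ v, x v • (Pi.single v 1 - Pi.single r 1 : V → ℤ) := by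
      simp only [smul_sub, Finset.sum_sub_distrib, ← Finset.sum_smul, hx0, zero_smul, sub_zero]
      ext w
      simp [Finset.sum_apply, Pi.single_apply]
    rw [hsum]
    refine Submodule.sum_mem _ fun v _ => Submodule.smul_mem _ _ ?_
    obtain ⟨z, -, hz⟩ := exists_unit_flow_of_reachable hcol (h.preconnected r v)
    exact ⟨z, hz⟩
  have htop : LinearMap.range total = ⊤ :=
    LinearMap.range_eq_top.2 fun t => ⟨Pi.single r t, by simp [htotal]⟩
  have h1 := (LinearMap.ker B.mulVecLin).finrank_quotient_add_finrank
  have h2 := (LinearMap.ker total).finrank_quotient_add_finrank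
  rw [total.quotKerEquivRange.finrank_eq, htop, finrank_top, Module.finrank_self, ← hrange,
    Module.finrank_pi] at h2
  rw [B.mulVecLin.quotKerEquivRange.finrank_eq, Module.finrank_pi] at h1
  omega

/-- Each cycle of an integral cycle basis can be assigned an arc on it, so that the arcs off a
given spanning tree are each used exactly once. -/
theorem IsSpanningTree.exists_transversal [Fintype V]
    (hcol : ∀ a, B *ᵥ Pi.single a 1 = Pi.single (head a) 1 - Pi.single (tail a) 1)
    {Γ : Matrix C A ℤ} (hΓindep : LinearIndependent ℤ (fun c : C => Γ c))
    (hΓspan : Submodule.span ℤ (Set.range fun c : C => Γ c) = LinearMap.ker B.mulVecLin)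
    {S : Finset A} (hS : IsSpanningTree tail head S) :
    ∃ f : C → A, Function.Injective f ∧ Finset.univ.image f = Sᶜ ∧ ∀ c, Γ c (f c) ≠ 0 := by
  classical
  obtain ⟨hcard, hconn⟩ := hS
  have hcardC : Fintype.card C = Fintype.card (Sᶜ : Finset A) := by
    have h1 := finrank_ker_add_card_of_connected hcol hconn
    rw [← hΓspan, finrank_span_eq_card hΓindep] at h1
    have : 0 < Fintype.card V := Fintype.card_pos_iff.2 hconn.nonempty
    rw [Fintype.card_coe, Finset.card_compl]
    omega
  let e : C ≃ (Sᶜ : Finset A) := Fintype.equivOfCardEq hcardC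
  have hfund (c : C) : ∃ n : C → ℤ, ∀ c', ∑ k, n k * Γ k (e c') = if c = c' then 1 else 0 := by
    obtain ⟨z, hz, hBz⟩ :=
      exists_unit_flow_of_reachable hcol (hconn.preconnected (tail (e c)) (head (e c)))
    have hmem : Pi.single (e c : A) 1 - z ∈ Submodule.span ℤ (Set.range fun c : C => Γ c) := by
      rw [hΓspan, LinearMap.mem_ker, mulVecLin_apply, mulVec_sub, hcol, hBz, sub_self]
    obtain ⟨n, hn⟩ := (Submodule.mem_span_range_iff_exists_fun ℤ).1 hmem
    refine ⟨n, fun c' => ?_⟩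
    have hzero : z (e c') = 0 := hz _ (Finset.mem_compl.1 (e c').2)
    have := congrFun hn (e c')
    simpa [hzero, Finset.sum_apply, Pi.single_apply, eq_comm] using this
  choose N hN using hfund
  have hinv : Matrix.of N * Γ.submatrix id (fun c => (e c : A)) = 1 := by
    ext c c'
    simp [Matrix.mul_apply, hN, Matrix.one_apply]
  have hdet : (Γ.submatrix id (fun c => (e c : A))).det ≠ 0 := by
    intro h0
    simpa [h0] using congrArg Matrix.det hinv
  rw [Matrix.det_apply] at hdet
  obtain ⟨σ, -, hσ⟩ := Finset.exists_ne_zero_of_sum_ne_zero hdet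
  have hprod : ∏ c, Γ (σ c) (e c) ≠ 0 := fun h0 => hσ (by simp [h0])
  refine ⟨fun c => e (σ.symm c), ?_, ?_, fun c => ?_⟩
  · exact Subtype.val_injective.comp (e.injective.comp σ.symm.injective)
  · ext a
    simp only [Finset.mem_image, Finset.mem_univ, true_and]
    refine ⟨?_, fun ha => ⟨σ (e.symm ⟨a, ha⟩), by simp⟩⟩
    rintro ⟨c, rfl⟩
    exact (e _).2
  · simpa using Finset.prod_ne_zero_iff.1 hprod (σ.symm c) (Finset.mem_univ _)

end SpanningTreeCycleBasis

theorem spanning_tree_sum_le_cycle_product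
    {V A C : Type*} [Fintype V] [Fintype A] [Fintype C]
    [DecidableEq V] [DecidableEq A]
    (tail head : A → V) (hth : ∀ a, tail a ≠ head a)
    (B : Matrix V A ℤ)
    (hB : ∀ v a, B v a = if v = head a then 1 else if v = tail a then -1 else 0)
    (Γ : Matrix C A ℤ)
    (hΓentries : ∀ c a, Γ c a = -1 ∨ Γ c a = 0 ∨ Γ c a = 1)
    (hΓindep : LinearIndependent ℤ (fun c : C => Γ c))
    (hΓspan : Submodule.span ℤ (Set.range fun c : C => Γ c)
      = LinearMap.ker B.mulVecLin)
    (d : A → ℝ) (hd : ∀ a, 0 ≤ d a) :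
    (∑ᶠ S ∈ {S : Finset A | IsSpanningTree tail head S}, ∏ a ∈ Sᶜ, d a)
      ≤ ∏ c : C, ∑ a ∈ Finset.univ.filter (fun a => Γ c a ≠ 0), d a := by
  classical
  have hcol (a : A) : B *ᵥ Pi.single a 1 = Pi.single (head a) 1 - Pi.single (tail a) 1 := by
    ext v
    have := hth a
    simp only [mulVec_single_one, col_apply, hB, Pi.sub_apply, Pi.single_apply]
    grind
  have htrans (S : {S : Finset A | IsSpanningTree tail head S}) :=
    S.2.exists_transversal hcol hΓindep hΓspan
  choose f hf_inj hf_image hf_ne using htrans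
  have hf : Function.Injective f := fun S T hST => by
    rw [← Subtype.val_inj, ← compl_inj_iff, ← hf_image S, ← hf_image T, hST]
  calc ∑ᶠ S ∈ {S : Finset A | IsSpanningTree tail head S}, ∏ a ∈ Sᶜ, d a
    _ = ∑ S : {S : Finset A | IsSpanningTree tail head S}, ∏ c, d (f S c) := by
      rw [← finsum_set_coe_eq_finsum_mem, finsum_eq_sum_of_fintype]
      refine Finset.sum_congr rfl fun S _ => ?_
      rw [← hf_image S, Finset.prod_image (hf_inj S).injOn]
    _ = ∑ g ∈ Finset.univ.image f, ∏ c, d (g c) := by rw [Finset.sum_image hf.injOn]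
    _ ≤ ∑ g ∈ Fintype.piFinset fun c => Finset.univ.filter (fun a => Γ c a ≠ 0),
          ∏ c, d (g c) := by
      refine Finset.sum_le_sum_of_subset_of_nonneg (fun g hg => ?_)
        fun g _ _ => Finset.prod_nonneg fun c _ => hd _
      obtain ⟨S, -, rfl⟩ := Finset.mem_image.1 hg
      simpa using hf_ne S
    _ = ∏ c : C, ∑ a ∈ Finset.univ.filter (fun a => Γ c a ≠ 0), d a :=
      (Finset.prod_univ_sum _ _).symm
end

section
/- Let G be a finite directed graph and let Γ : Matrix C A ℤ be an integral cycle basis matrix of G. Then the number of spanning trees of G is at most the product of the lengths of the cycles in the basis: |𝒮(G)| ≤ ∏_{c ∈ C} |{a : A | Γ c a ≠ 0}|. -/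
open Matrix

/-- A function that takes equal values at the two ends of every arc of a connected graph is
constant. -/
theorem eq_of_connected_edgeGraph {V A K : Type*} {tail head : A → V} {S : Set A}
    (hS : (edgeGraph tail head S).Connected) {x : V → K}
    (hx : ∀ a ∈ S, x (head a) = x (tail a)) (v w : V) : x v = x w := by
  obtain ⟨p⟩ := hS.preconnected v w
  induction p with
  | nil => rfl
  | cons h _ ih =>
    rw [← ih]
    obtain ⟨-, ⟨a, ha, rfl, rfl⟩ | ⟨a, ha, rfl, rfl⟩⟩ := h
    · exact (hx a ha).symm
    · exact hx a ha

/-- On a spanning tree, every assignment of rational numbers to the arcs is a potential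
difference. -/
theorem IsSpanningTree.exists_potential {V A : Type*} [Fintype V] {tail head : A → V}
    {S : Finset A} (hS : IsSpanningTree tail head S) (z : S → ℚ) :
    ∃ x : V → ℚ, ∀ a : S, x (head a) - x (tail a) = z a := by
  obtain ⟨hcard, hconn⟩ := hS
  obtain ⟨r⟩ := hconn.nonempty
  let δ : (V → ℚ) →ₗ[ℚ] (S → ℚ) :=
    { toFun := fun x a => x (head a) - x (tail a)
      map_add' := fun x y => by ext a; simp only [Pi.add_apply]; ring
      map_smul' := fun c x => by
        ext a; simp only [Pi.smul_apply, smul_eq_mul, RingHom.id_apply]; ring }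
  have hker : Module.finrank ℚ (LinearMap.ker δ) ≤ 1 := by
    have hinj : Function.Injective
        ((LinearMap.proj r : (V → ℚ) →ₗ[ℚ] ℚ) ∘ₗ (LinearMap.ker δ).subtype) := by
      rw [← LinearMap.ker_eq_bot, LinearMap.ker_eq_bot']
      rintro ⟨x, hx⟩ hxr
      ext v
      refine (eq_of_connected_edgeGraph hconn (fun a ha => ?_) v r).trans hxr
      exact sub_eq_zero.mp (congrFun (LinearMap.mem_ker.mp hx) ⟨a, ha⟩)
    simpa using LinearMap.finrank_le_finrank_of_injective hinj
  have hrank := δ.finrank_range_add_finrank_ker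
  rw [Module.finrank_fintype_fun_eq_card] at hrank
  have hle := Submodule.finrank_le (LinearMap.range δ)
  have htop : LinearMap.range δ = ⊤ := by
    apply Submodule.eq_top_of_finrank_eq
    rw [Module.finrank_fintype_fun_eq_card, Fintype.card_coe] at hle ⊢
    omega
  obtain ⟨x, hx⟩ := LinearMap.range_eq_top.mp htop z
  exact ⟨x, fun a => congrFun hx a⟩

/-- The sum of a potential against the boundary of a chain is the sum of the chain against
the potential differences. -/
theorem sum_mul_mulVec_incidence {V A : Type*} [Fintype V] [Fintype A] [DecidableEq V]
    {tail head : A → V} (hth : ∀ a, tail a ≠ head a) {B : Matrix V A ℤ}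
    (hB : ∀ v a, B v a = if v = head a then 1 else if v = tail a then -1 else 0)
    (x : V → ℚ) (y : A → ℤ) :
    ∑ v, x v * ((B *ᵥ y) v : ℤ) = ∑ a, (x (head a) - x (tail a)) * y a := by
  have hcol (a : A) : ∑ v, x v * (B v a : ℚ) = x (head a) - x (tail a) := by
    have h (v : V) : x v * (B v a : ℚ) =
        (if v = head a then x v else 0) - (if v = tail a then x v else 0) := by
      have := hth a
      rw [hB]
      split_ifs <;> simp_all
    simp [h, Finset.sum_sub_distrib]
  simp only [Matrix.mulVec, dotProduct, Int.cast_sum, Int.cast_mul, Finset.mul_sum, ← hcol,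
    Finset.sum_mul]
  rw [Finset.sum_comm]
  simp only [mul_assoc]

/-- An integral flow supported on a spanning tree vanishes. -/
theorem IsSpanningTree.eq_zero_of_mulVec_eq_zero {V A : Type*} [Fintype V] [Fintype A]
    [DecidableEq V] {tail head : A → V} {S : Finset A} (hS : IsSpanningTree tail head S)
    (hth : ∀ a, tail a ≠ head a) {B : Matrix V A ℤ}
    (hB : ∀ v a, B v a = if v = head a then 1 else if v = tail a then -1 else 0)
    {y : A → ℤ} (hy : B *ᵥ y = 0) (hyS : ∀ a ∉ S, y a = 0) : y = 0 := by
  classical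
  ext b
  by_cases hb : b ∈ S
  · obtain ⟨x, hx⟩ := hS.exists_potential (Pi.single ⟨b, hb⟩ 1)
    have hsum := sum_mul_mulVec_incidence hth hB x y
    rw [hy, Finset.sum_eq_single b] at hsum
    · simpa [hx ⟨b, hb⟩] using hsum.symm
    · intro a _ hab
      by_cases ha : a ∈ S
      · simp [hx ⟨a, ha⟩, hab]
      · simp [hyS a ha]
    · simp
  · exact hyS b hb

/-- The boundary map of a nonempty graph has rank at most `|V| - 1`. -/
theorem finrank_range_incidence_lt {V A : Type*} [Fintype V] [Nonempty V] [Fintype A]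
    [DecidableEq V] {tail head : A → V} (hth : ∀ a, tail a ≠ head a) {B : Matrix V A ℤ}
    (hB : ∀ v a, B v a = if v = head a then 1 else if v = tail a then -1 else 0) :
    Module.finrank ℤ (LinearMap.range B.mulVecLin) < Fintype.card V := by
  let σ : (V → ℤ) →ₗ[ℤ] ℤ := ∑ v, LinearMap.proj v
  have hσ (x : V → ℤ) : σ x = ∑ v, x v := by simp [σ]
  have hsurj : LinearMap.range σ = ⊤ := by
    rw [LinearMap.range_eq_top]
    intro n
    exact ⟨Pi.single (Classical.arbitrary V) n, by simp [hσ]⟩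
  have hle : LinearMap.range B.mulVecLin ≤ LinearMap.ker σ := by
    rintro _ ⟨y, rfl⟩
    have h := sum_mul_mulVec_incidence hth hB 1 y
    rw [LinearMap.mem_ker, hσ]
    simp only [Pi.one_apply, one_mul, sub_self, zero_mul, Finset.sum_const_zero] at h
    exact_mod_cast h
  have hrank := (LinearMap.ker σ).finrank_quotient_add_finrank
  rw [σ.quotKerEquivRange.finrank_eq] at hrank
  rw [hsurj, finrank_top, Module.finrank_self, Module.finrank_fintype_fun_eq_card] at hrank
  have := Submodule.finrank_mono hle
  omega

/-- The size of a cycle basis is the number of arcs outside a spanning tree. -/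
theorem IsSpanningTree.card_compl_eq {V A C : Type*} [Fintype V] [Fintype A] [Fintype C]
    [DecidableEq V] [DecidableEq A] {tail head : A → V} {S : Finset A}
    (hS : IsSpanningTree tail head S) (hth : ∀ a, tail a ≠ head a) {B : Matrix V A ℤ}
    (hB : ∀ v a, B v a = if v = head a then 1 else if v = tail a then -1 else 0)
    {Γ : Matrix C A ℤ} (hΓindep : LinearIndependent ℤ (fun c : C => Γ c))
    (hΓspan : Submodule.span ℤ (Set.range fun c : C => Γ c) = LinearMap.ker B.mulVecLin) :
    Fintype.card C = Fintype.card (Sᶜ : Finset A) := by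
  have := hS.2.nonempty
  have hC : Module.finrank ℤ (LinearMap.ker B.mulVecLin) = Fintype.card C := by
    rw [← hΓspan, finrank_span_eq_card hΓindep]
  apply le_antisymm
  · let ρ : (A → ℤ) →ₗ[ℤ] ((Sᶜ : Finset A) → ℤ) := LinearMap.funLeft ℤ ℤ Subtype.val
    have hinj : Function.Injective (ρ ∘ₗ (LinearMap.ker B.mulVecLin).subtype) := by
      rw [← LinearMap.ker_eq_bot, LinearMap.ker_eq_bot']
      rintro ⟨y, hy⟩ hρ
      refine Subtype.ext (hS.eq_zero_of_mulVec_eq_zero hth hB hy fun a ha => ?_)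
      exact congrFun hρ ⟨a, Finset.mem_compl.mpr ha⟩
    simpa [hC] using LinearMap.finrank_le_finrank_of_injective hinj
  · have hrank := (LinearMap.ker B.mulVecLin).finrank_quotient_add_finrank
    rw [B.mulVecLin.quotKerEquivRange.finrank_eq] at hrank
    rw [hC, Module.finrank_fintype_fun_eq_card] at hrank
    have hlt := finrank_range_incidence_lt hth hB
    rw [Fintype.card_coe, Finset.card_compl, hS.1]
    omega

/-- The arcs outside a spanning tree form a system of distinct representatives for the supports
of the cycles in a cycle basis. -/
theorem IsSpanningTree.exists_representatives {V A C : Type*} [Fintype V] [Fintype A]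
    [Fintype C] [DecidableEq V] [DecidableEq A] {tail head : A → V} {S : Finset A}
    (hS : IsSpanningTree tail head S) (hth : ∀ a, tail a ≠ head a) {B : Matrix V A ℤ}
    (hB : ∀ v a, B v a = if v = head a then 1 else if v = tail a then -1 else 0)
    {Γ : Matrix C A ℤ} (hΓindep : LinearIndependent ℤ (fun c : C => Γ c))
    (hΓspan : Submodule.span ℤ (Set.range fun c : C => Γ c) = LinearMap.ker B.mulVecLin) :
    ∃ f : C → A, (∀ c, Γ c (f c) ≠ 0) ∧ (Finset.univ.image f)ᶜ = S := by
  classical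
  obtain ⟨e⟩ := Fintype.card_eq.mp (hS.card_compl_eq hth hB hΓindep hΓspan)
  have hdet : (Γ.submatrix id fun c => (e c : A)).det ≠ 0 := by
    intro h
    obtain ⟨v, hv, hvM⟩ := Matrix.exists_vecMul_eq_zero_iff.mpr h
    have hmem : v ᵥ* Γ ∈ LinearMap.ker B.mulVecLin := by
      rw [← hΓspan, Matrix.vecMul_eq_sum]
      exact Submodule.sum_mem _ fun c _ =>
        Submodule.smul_mem _ _ (Submodule.subset_span ⟨c, rfl⟩)
    have hzero : v ᵥ* Γ = 0 := by
      refine hS.eq_zero_of_mulVec_eq_zero hth hB hmem fun a ha => ?_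
      have := congrFun hvM (e.symm ⟨a, Finset.mem_compl.mpr ha⟩)
      simpa [Matrix.vecMul, dotProduct] using this
    rw [Matrix.vecMul_eq_sum] at hzero
    exact hv (funext (Fintype.linearIndependent_iff.mp hΓindep v hzero))
  rw [Matrix.det_apply] at hdet
  obtain ⟨τ, -, hτ⟩ := Finset.exists_ne_zero_of_sum_ne_zero hdet
  have hprod := right_ne_zero_of_smul hτ
  rw [Finset.prod_ne_zero_iff] at hprod
  refine ⟨fun c => e (τ.symm c), fun c => by simpa using hprod (τ.symm c) (Finset.mem_univ _), ?_⟩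
  rw [compl_eq_comm]
  ext a
  simp only [Finset.mem_image, Finset.mem_univ, true_and]
  constructor
  · intro ha
    exact ⟨τ (e.symm ⟨a, ha⟩), by simp⟩
  · rintro ⟨c, rfl⟩
    exact (e _).2

theorem card_spanning_trees_le_prod_cycle_lengths
    {V A C : Type*} [Fintype V] [Fintype A] [Fintype C] [DecidableEq V]
    (tail head : A → V) (hth : ∀ a, tail a ≠ head a)
    (B : Matrix V A ℤ)
    (hB : ∀ v a, B v a = if v = head a then 1 else if v = tail a then -1 else 0)
    (Γ : Matrix C A ℤ)
    (hΓentries : ∀ c a, Γ c a = -1 ∨ Γ c a = 0 ∨ Γ c a = 1)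
    (hΓindep : LinearIndependent ℤ (fun c : C => Γ c))
    (hΓspan : Submodule.span ℤ (Set.range fun c : C => Γ c)
      = LinearMap.ker B.mulVecLin) :
    {S : Finset A | IsSpanningTree tail head S}.ncard
      ≤ ∏ c : C, (Finset.univ.filter (fun a => Γ c a ≠ 0)).card := by
  classical
  have hsub : {S : Finset A | IsSpanningTree tail head S} ⊆
      ↑((Fintype.piFinset fun c : C => Finset.univ.filter fun a => Γ c a ≠ 0).image
        fun f => (Finset.univ.image f)ᶜ) := by
    intro S hS
    obtain ⟨f, hf, hfS⟩ := hS.exists_representatives hth hB hΓindep hΓspan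
    exact Finset.mem_coe.mpr (Finset.mem_image.mpr ⟨f, by simpa using hf, hfS⟩)
  refine (Set.ncard_le_ncard hsub (Finset.finite_toSet _)).trans ?_
  rw [Set.ncard_coe_finset]
  exact Finset.card_image_le.trans (by rw [Fintype.card_piFinset])
end
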